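/- Let E be a set, I ⊆ E × E an irreflexive symmetric relation, and M(E,I) the free partially commutative monoid. For any ring R with 1, the global dimension of the monoid ring R[M(E,I)] (the global dimension of the category of left R[M(E,I)]-modules) equals ω(E,I) + gld R, where ω(E,I) is the clique number of the independence graph, with the convention that the sum is ∞ if either summand is ∞. -/

import Mathlib

open CategoryTheory CategoryTheory.Limits

universe w w' v u u₁ v₁ u₂ v₂

/-- The elementary commutation relation. -/
def traceRel (E : Type u) (I : E → E → Prop) : FreeMonoid E → FreeMonoid E → Prop :=
  fun x y => ∃ a b, I a b ∧ x = FreeMonoid.of a * FreeMonoid.of b ∧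
    y = FreeMonoid.of b * FreeMonoid.of a

/-- The congruence generated by the commutation relations. -/
def traceCon (E : Type u) (I : E → E → Prop) : Con (FreeMonoid E) := conGen (traceRel E I)

/-- The free partially commutative (trace) monoid `M(E,I)`. -/
def TraceMonoid (E : Type u) (I : E → E → Prop) : Type u := (traceCon E I).Quotient

instance (E : Type u) (I : E → E → Prop) : Monoid (TraceMonoid E I) :=
  Con.monoid (traceCon E I)

/-- The canonical generator map `E → M(E,I)`. -/
def TraceMonoid.of (E : Type u) (I : E → E → Prop) (a : E) : TraceMonoid E I :=
  (traceCon E I).mk' (FreeMonoid.of a)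

/-- The clique number of the independence graph `(E, I)`:  the supremum of the
cardinalities of finite sets of pairwise `I`-related (distinct) elements
(finite complete subgraphs). -/
noncomputable def cliqueNumber (E : Type u) (I : E → E → Prop) : ℕ∞ :=
  ⨆ (s : {s : Finset E // ∀ a ∈ s, ∀ b ∈ s, a ≠ b → I a b}), (s.1.card : ℕ∞)

/-- The global dimension of an abelian category `𝒜`:  the supremum in
`{-1} ∪ ℕ ∪ {∞}` of those `n ∈ ℕ` for which `Ext^n(A, B) ≠ 0` for some objects
`A`, `B` of `𝒜` (with `sup ∅ = -1`). -/
noncomputable def globalDimension (𝒜 : Type u₁) [Category.{v₁} 𝒜] [Abelian 𝒜]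
    [HasExt.{w} 𝒜] : WithBot ℕ∞ :=
  sSup {d : WithBot ℕ∞ | ∃ (n : ℕ) (A B : 𝒜) (e : Abelian.Ext A B n),
    e ≠ 0 ∧ d = ((n : ℕ∞) : WithBot ℕ∞)}

/-- The global dimension of a ring `R` with `1`:  the global dimension of the category
of left `R`-modules. -/
noncomputable def ringGlobalDimension (R : Type u₁) [Ring R]
    [HasExt.{w} (ModuleCat.{u₁} R)] : WithBot ℕ∞ :=
  globalDimension.{w} (ModuleCat.{u₁} R)

section ProjectiveDimension

variable {R : Type u} [Ring R]

/-- The `R`-module `N` has projective dimension `< n`. -/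
def PdLT (R : Type u) [Ring R] (N : Type u) [AddCommGroup N] [Module R N] (n : ℕ) : Prop :=
  HasProjectiveDimensionLT (ModuleCat.of R N) n

variable {X Y Z : Type u} [AddCommGroup X] [AddCommGroup Y] [AddCommGroup Z]
  [Module R X] [Module R Y] [Module R Z]

theorem pdLT_zero_iff : PdLT R X 0 ↔ Subsingleton X := by
  rw [PdLT, hasProjectiveDimensionLT_zero_iff_isZero, ModuleCat.isZero_iff_subsingleton]

theorem pdLT_one_iff : PdLT R X 1 ↔ Module.Projective R X := by
  rw [PdLT, ← projective_iff_hasProjectiveDimensionLT_one, ← IsProjective.iff_projective]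

theorem PdLT.mono {m n : ℕ} (h : PdLT R X m) (hmn : m ≤ n) : PdLT R X n :=
  have : HasProjectiveDimensionLT (ModuleCat.of R X) m := h
  hasProjectiveDimensionLT_of_ge _ m n hmn

theorem PdLT.of_projective [h : Module.Projective R X] (n : ℕ) : PdLT R X (n + 1) :=
  (pdLT_one_iff.2 h).mono (by lia)

theorem PdLT.of_retract {n : ℕ} (h : PdLT R Y n) (i : X →ₗ[R] Y) (r : Y →ₗ[R] X)
    (hri : ∀ x, r (i x) = x) : PdLT R X n :=
  have : HasProjectiveDimensionLT (ModuleCat.of R Y) n := h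
  Retract.hasProjectiveDimensionLT (X := ModuleCat.of R X) (Y := ModuleCat.of R Y)
    ⟨ModuleCat.ofHom i, ModuleCat.ofHom r, by ext x; exact hri x⟩ n

theorem PdLT.of_equiv {n : ℕ} (h : PdLT R Y n) (e : X ≃ₗ[R] Y) : PdLT R X n :=
  h.of_retract e.toLinearMap e.symm.toLinearMap e.symm_apply_apply

section Exact

variable {f : X →ₗ[R] Y} {g : Y →ₗ[R] Z}

theorem shortExact_ofHom (hf : Function.Injective f) (hfg : Function.Exact f g)
    (hg : Function.Surjective g) :
    (ShortComplex.mk (ModuleCat.ofHom f) (ModuleCat.ofHom g)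
      (by ext x; exact hfg.apply_apply_eq_zero x)).ShortExact where
  exact := (ShortComplex.ShortExact.moduleCat_exact_iff_function_exact _).2 hfg
  mono_f := (ModuleCat.mono_iff_injective _).2 hf
  epi_g := (ModuleCat.epi_iff_surjective _).2 hg

theorem PdLT.left (hf : Function.Injective f) (hfg : Function.Exact f g)
    (hg : Function.Surjective g) {n : ℕ} (hY : PdLT R Y n) (hZ : PdLT R Z (n + 1)) :
    PdLT R X n :=
  (shortExact_ofHom hf hfg hg).hasProjectiveDimensionLT_X₁ n hY hZ

theorem PdLT.right (hf : Function.Injective f) (hfg : Function.Exact f g)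
    (hg : Function.Surjective g) {n : ℕ} (hX : PdLT R X n) (hY : PdLT R Y (n + 1)) :
    PdLT R Z (n + 1) :=
  (shortExact_ofHom hf hfg hg).hasProjectiveDimensionLT_X₃ n hX hY

end Exact

theorem PdLT.ker {g : Y →ₗ[R] Z} (hg : Function.Surjective g) {n : ℕ} (hY : PdLT R Y n)
    (hZ : PdLT R Z (n + 1)) : PdLT R (LinearMap.ker g) n :=
  PdLT.left (LinearMap.ker g).injective_subtype (LinearMap.exact_subtype_ker_map g) hg hY hZ

theorem PdLT.of_ker {g : Y →ₗ[R] Z} (hg : Function.Surjective g) {n : ℕ}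
    (hX : PdLT R (LinearMap.ker g) n) (hY : PdLT R Y (n + 1)) : PdLT R Z (n + 1) :=
  PdLT.right (LinearMap.ker g).injective_subtype (LinearMap.exact_subtype_ker_map g) hg hX hY

theorem surjective_linearCombination_id (R : Type u) [Ring R] (X : Type u) [AddCommGroup X]
    [Module R X] : Function.Surjective (Finsupp.linearCombination R (id : X → X)) :=
  fun x => ⟨Finsupp.single x 1, by simp⟩

end ProjectiveDimension

section Restriction

variable {A B : Type u} [Ring A] [Ring B] (i : B →+* A)
  (hi : @Module.Projective B _ A _ (Module.compHom A i))

include hi in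
theorem projective_of_restrict (N : Type u) [AddCommGroup N] [Module A N] [Module B N]
    (h : ∀ (b : B) (x : N), b • x = i b • x) [Module.Projective A N] : Module.Projective B N := by
  let := Module.compHom A i
  have : Module.Projective B A := hi
  have : Module.Projective B (N →₀ A) := by
    classical exact .of_equiv' (finsuppLequivDFinsupp B).symm
  obtain ⟨s, hs⟩ := (Module.projective_def (R := A) (P := N)).1 ‹_›
  let s' : N →ₗ[B] (N →₀ A) :=
    { toFun := s
      map_add' := map_add s
      map_smul' := fun b x => by
        rw [h, map_smul]
        rfl }
  let g' : (N →₀ A) →ₗ[B] N :=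
    { toFun := Finsupp.linearCombination A id
      map_add' := map_add _
      map_smul' := fun b x => by
        rw [RingHom.id_apply, h, ← map_smul]
        rfl }
  exact Module.Projective.of_split s' g' (LinearMap.ext fun x => hs x)

include hi in
theorem PdLT.restrict (n : ℕ) : ∀ (N : Type u) [AddCommGroup N] [Module A N] [Module B N]
    (_ : ∀ (b : B) (x : N), b • x = i b • x), PdLT A N n → PdLT B N n := by
  induction n with
  | zero => intro N _ _ _ _; simp only [pdLT_zero_iff, imp_self]
  | succ n ih =>
    intro N _ _ _ h hN
    cases n with
    | zero =>
      rw [zero_add, pdLT_one_iff] at hN ⊢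
      exact projective_of_restrict i hi N h
    | succ n =>
      let := Module.compHom A i
      have hF := projective_of_restrict i hi (N →₀ A) fun _ _ => rfl
      let g := Finsupp.linearCombination A (id : N → N)
      have hg := surjective_linearCombination_id A N
      let g' : (N →₀ A) →ₗ[B] N :=
        { toFun := g
          map_add' := map_add g
          map_smul' := fun b x => by
            rw [RingHom.id_apply, h, ← map_smul]
            rfl }
      have hK := PdLT.ker hg (PdLT.of_projective n) hN
      have hK' : PdLT B (LinearMap.ker g') (n + 1) := by
        let : Module B (LinearMap.ker g) := Module.compHom _ i
        let e : LinearMap.ker g' ≃ₗ[B] LinearMap.ker g :=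
          { toFun := fun x => ⟨x.1, x.2⟩
            invFun := fun x => ⟨x.1, x.2⟩
            map_add' := fun _ _ => rfl
            map_smul' := fun _ _ => rfl }
        exact (ih (LinearMap.ker g) (fun _ _ => rfl) hK).of_equiv e
      exact PdLT.of_ker (g := g') hg hK' (PdLT.of_projective _)

end Restriction

/-- Every `R`-module has projective dimension `< n`. -/
def GldLT (R : Type u) [Ring R] (n : ℕ) : Prop :=
  ∀ (N : Type u) [AddCommGroup N] [Module R N], PdLT R N n

theorem GldLT.of_ringHom {A B : Type u} [Ring A] [Ring B] (i : B →+* A)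
    (hi : @Module.Projective B _ A _ (Module.compHom A i)) (p : A →+* B) (hp : ∀ b, p (i b) = b)
    {n : ℕ} (h : GldLT A n) : GldLT B n := by
  intro N _ _
  let := Module.compHom N p
  refine PdLT.restrict i hi n N (fun b x => ?_) (h N)
  exact congrArg (· • x) (hp b).symm

theorem GldLT.of_ringEquiv {A B : Type u} [Ring A] [Ring B] (e : B ≃+* A)
    {n : ℕ} (h : GldLT A n) : GldLT B n := by
  refine h.of_ringHom e.toRingHom ?_ e.symm.toRingHom e.symm_apply_apply
  let := Module.compHom A e.toRingHom
  exact Module.Projective.of_equiv' (M := B) (P := A)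
    { e.toAddEquiv with map_smul' := fun a b => map_mul e a b }

section Polynomial

open Polynomial

variable {B : Type u} [Ring B]

theorem subsingleton_of_projective_polynomial (N : Type u) [AddCommGroup N] [Module B N]
    [Module B[X] N] (h : ∀ (p : B[X]) (x : N), p • x = p.coeff 0 • x)
    [Module.Projective B[X] N] : Subsingleton N := by
  obtain ⟨s, hs⟩ := (Module.projective_def (R := B[X]) (P := N)).1 ‹_›
  refine subsingleton_of_forall_eq 0 fun x => ?_
  have hx : (X : B[X]) • s x = 0 := by
    rw [← map_smul, h, coeff_X_zero, zero_smul, map_zero]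
  have : s x = 0 := by
    ext1 y
    have := DFunLike.congr_fun hx y
    rw [Finsupp.smul_apply, smul_eq_mul, X_mul] at this
    exact (Polynomial.monic_X.mul_left_eq_zero_iff).1 this
  rw [← hs x, this, map_zero]

/-- The functional `ω ↦ ∑ x, (ω x)₁ • x` on the relations of a module killed by `X`. -/
noncomputable def linearCoeff (N : Type u) [AddCommGroup N] [Module B N]
    [Module B[X] N] (h : ∀ (p : B[X]) (x : N), p • x = p.coeff 0 • x) :
    LinearMap.ker (Finsupp.linearCombination B[X] (id : N → N)) →ₗ[B[X]] N where
  toFun f := f.1.sum fun x p => p.coeff 1 • x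
  map_add' f g := by
    refine Finsupp.sum_add_index' ?_ ?_ <;> simp [add_smul]
  map_smul' p f := by
    have hf : f.1.sum (fun x q => q.coeff 0 • x) = 0 := by
      have := f.2
      rw [LinearMap.mem_ker, Finsupp.linearCombination_apply] at this
      simpa only [h, id] using this
    rw [RingHom.id_apply, h, Finsupp.smul_sum, SetLike.val_smul, Finsupp.sum_smul_index (by simp)]
    simp only [mul_coeff_one, add_smul, Finsupp.sum_add, mul_smul]
    rw [← Finsupp.smul_sum (c := p.coeff 1) (v := f.1), hf, smul_zero, add_zero]

theorem projective_of_pdLT_two (N : Type u) [AddCommGroup N] [Module B N]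
    [Module B[X] N] (h : ∀ (p : B[X]) (x : N), p • x = p.coeff 0 • x)
    (hN : PdLT B[X] N 2) : Module.Projective B N := by
  set g := Finsupp.linearCombination B[X] (id : N → N) with hgdef
  have hker := PdLT.ker (surjective_linearCombination_id B[X] N) (PdLT.of_projective 0) hN
  rw [zero_add, pdLT_one_iff] at hker
  let : Module B[X] (N →₀ B) := Module.compHom _ constantCoeff
  have hsmul : ∀ (p : B[X]) (f : N →₀ B), p • f = p.coeff 0 • f := fun _ _ => rfl
  let g' : (N →₀ B) →ₗ[B[X]] N :=
    { toFun := Finsupp.linearCombination B id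
      map_add' := map_add _
      map_smul' := fun p f => by rw [hsmul, map_smul, RingHom.id_apply, h] }
  obtain ⟨r, hr⟩ := Module.projective_lifting_property g' (linearCoeff N h)
    (surjective_linearCombination_id B N)
  have hmem : ∀ f : N →₀ B[X], (X : B[X]) • f ∈ LinearMap.ker g := fun f => by
    rw [LinearMap.mem_ker, map_smul, h, coeff_X_zero, zero_smul]
  let t (f : N →₀ B[X]) : N →₀ B := r ⟨_, hmem f⟩
  have tadd : ∀ f f', t (f + f') = t f + t f' := fun f f' => by
    rw [← map_add]
    exact congrArg r (Subtype.ext (smul_add _ _ _))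
  have tker : ∀ f, g f = 0 → t f = 0 := fun f hf => by
    have : t f = (X : B[X]) • r ⟨f, hf⟩ := by
      rw [← map_smul]; rfl
    rw [this, hsmul, coeff_X_zero, zero_smul]
  have tsmul : ∀ (b : B) f, t (C b • f) = b • t f := fun b f => by
    have : t (C b • f) = C b • t f := by
      rw [← map_smul]
      refine congrArg r (Subtype.ext ?_)
      change (X : B[X]) • C b • f = C b • (X : B[X]) • f
      rw [smul_smul, smul_smul, X_mul]
    rw [this, hsmul, coeff_C_zero]
  have tg : ∀ f, t (Finsupp.single (g f) 1) = t f := fun f => by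
    have h1 : t (Finsupp.single (g f) 1 - f) = 0 := tker _ (by simp [g])
    have h2 := tadd (Finsupp.single (g f) 1 - f) f
    rwa [sub_add_cancel, h1, zero_add] at h2
  let s : N →ₗ[B] (N →₀ B) :=
    { toFun := fun x => t (Finsupp.single x 1)
      map_add' := fun x y => by
        rw [← tadd, ← tg (Finsupp.single x 1 + _)]
        simp [g]
      map_smul' := fun b x => by
        rw [RingHom.id_apply, ← tsmul, ← tg (C b • _)]
        simp [g, h] }
  refine Module.Projective.of_split s (Finsupp.linearCombination B id) (LinearMap.ext fun x => ?_)
  have := LinearMap.congr_fun hr ⟨_, hmem (Finsupp.single x 1)⟩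
  refine this.trans ?_
  simp [linearCoeff]

theorem pdLT_two_finsupp (ι : Type u) [Module B[X] (ι →₀ B)]
    (h : ∀ (p : B[X]) (f : ι →₀ B), p • f = p.coeff 0 • f) : PdLT B[X] (ι →₀ B) 2 := by
  let f : (ι →₀ B[X]) →ₗ[B[X]] (ι →₀ B[X]) :=
    { toFun := fun x => (X : B[X]) • x
      map_add' := smul_add _
      map_smul' := fun p x => by
        rw [RingHom.id_apply, smul_smul, smul_smul, X_mul] }
  let g : (ι →₀ B[X]) →ₗ[B[X]] (ι →₀ B) :=
    { toFun := Finsupp.mapRange (fun p => p.coeff 0) (coeff_zero 0)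
      map_add' := Finsupp.mapRange_add (fun p q => coeff_add p q 0)
      map_smul' := fun p x => by
        ext i
        simp [h, mul_coeff_zero] }
  refine PdLT.right (f := f) (g := g) (fun x y hxy => ?_) (fun x => ⟨fun hx => ?_, ?_⟩)
    (Finsupp.mapRange_surjective (fun p : B[X] => p.coeff 0) (coeff_zero 0)
      fun b => ⟨C b, coeff_C_zero⟩)
    (PdLT.of_projective 0) (PdLT.of_projective 1)
  · ext1 i
    have := DFunLike.congr_fun hxy i
    exact monic_X.isRegular.left this
  · refine ⟨Finsupp.mapRange divX divX_zero x, ?_⟩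
    ext1 i
    have h0 : (x i).coeff 0 = 0 := DFunLike.congr_fun hx i
    have := divX_mul_X_add (x i)
    rw [h0, C_0, add_zero] at this
    simpa [f, X_mul] using this
  · rintro ⟨y, rfl⟩
    exact (map_smul g X y).trans (by rw [h, coeff_X_zero, zero_smul])

theorem PdLT.of_polynomial (n : ℕ) : ∀ (N : Type u) [AddCommGroup N] [Module B N]
    [Module B[X] N] (_ : ∀ (p : B[X]) (x : N), p • x = p.coeff 0 • x),
    PdLT B[X] N (n + 1) → PdLT B N n := by
  induction n with
  | zero =>
    intro N _ _ _ h hN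
    rw [zero_add, pdLT_one_iff] at hN
    exact pdLT_zero_iff.2 (subsingleton_of_projective_polynomial N h)
  | succ n ih =>
    intro N _ _ _ h hN
    cases n with
    | zero => exact pdLT_one_iff.2 (projective_of_pdLT_two N h hN)
    | succ n =>
      let : Module B[X] (N →₀ B) := Module.compHom _ constantCoeff
      have hF := pdLT_two_finsupp N (B := B) fun _ _ => rfl
      let g := Finsupp.linearCombination B (id : N → N)
      have hg := surjective_linearCombination_id B N
      let g' : (N →₀ B) →ₗ[B[X]] N :=
        { toFun := g
          map_add' := map_add g
          map_smul' := fun p f => by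
            rw [RingHom.id_apply, h]
            exact map_smul g (p.coeff 0) f }
      have hK := PdLT.ker (g := g') hg (hF.mono (by lia : 2 ≤ n + 2)) hN
      have hK' : PdLT B (LinearMap.ker g) (n + 1) := by
        let : Module B[X] (LinearMap.ker g) := Module.compHom _ constantCoeff
        let e : LinearMap.ker g ≃ₗ[B[X]] LinearMap.ker g' :=
          { toFun := fun x => ⟨x.1, x.2⟩
            invFun := fun x => ⟨x.1, x.2⟩
            map_add' := fun _ _ => rfl
            map_smul' := fun _ _ => rfl }
        exact ih (LinearMap.ker g) (fun _ _ => rfl) (hK.of_equiv e)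
      exact PdLT.of_ker hg hK' (PdLT.of_projective _)

theorem GldLT.of_polynomial {n : ℕ} (h : GldLT B[X] (n + 1)) : GldLT B n := by
  intro N _ _
  let : Module B[X] N := Module.compHom _ constantCoeff
  exact PdLT.of_polynomial n N (fun _ _ => rfl) (h N)

end Polynomial

section Induced

/-- `R[M] ⊗_R N^(J)`, realised as finitely supported functions `M × J → N`. -/
def Ind (M J N : Type u) [AddCommGroup N] : Type u := M × J →₀ N

variable {M J N : Type u} [AddCommGroup N]

noncomputable instance : AddCommGroup (Ind M J N) := inferInstanceAs (AddCommGroup (M × J →₀ N))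

namespace Ind

/-- The element `m ⊗ x` in the copy of `R[M] ⊗_R N` indexed by `j`. -/
noncomputable def single (m : M) (j : J) : N →+ Ind M J N := Finsupp.singleAddHom (m, j)

/-- Extend additive maps from the summands of `Ind M J N`. -/
noncomputable def lift {Y : Type*} [AddCommGroup Y] (f : M → J → N →+ Y) : Ind M J N →+ Y :=
  Finsupp.liftAddHom fun p => f p.1 p.2

@[simp]
theorem lift_single {Y : Type*} [AddCommGroup Y] (f : M → J → N →+ Y) (m : M) (j : J) (x : N) :
    lift f (single m j x) = f m j x :=
  Finsupp.liftAddHom_apply_single _ _ _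

theorem induction {p : Ind M J N → Prop} (y : Ind M J N) (zero : p 0)
    (add : ∀ a b, p a → p b → p (a + b)) (single : ∀ m j x, p (single m j x)) : p y :=
  Finsupp.induction_linear y zero add fun q x => single q.1 q.2 x

theorem hom_ext {Y : Type*} [AddCommGroup Y] {f g : Ind M J N →+ Y}
    (h : ∀ m j x, f (single m j x) = g (single m j x)) : f = g :=
  Finsupp.addHom_ext fun p x => h p.1 p.2 x

/-- The action of `M` on `Ind M J N` by left translation. -/
noncomputable def translate [Monoid M] : M →* AddMonoid.End (Ind M J N) where
  toFun m := lift fun m' j => single (m * m') j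
  map_one' := hom_ext fun m j x => by
    rw [lift_single, one_mul]
    rfl
  map_mul' m m' := hom_ext fun n j x => by
    rw [lift_single, mul_assoc]
    change _ = lift (fun m' j => single (m * m') j) (lift (fun n j => single (m' * n) j) _)
    rw [lift_single, lift_single]

theorem translate_single [Monoid M] (m m' : M) (j : J) (x : N) :
    translate m (single m' j x) = single (m * m') j x :=
  lift_single _ _ _ _

variable {R : Type u} [Ring R] [Module R N]

/-- The coefficientwise action of `R` on `Ind M J N`. -/
noncomputable def scale : R →+* AddMonoid.End (Ind M J N) :=
  Module.toAddMonoidEnd R (M × J →₀ N)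

theorem scale_single (r : R) (m : M) (j : J) (x : N) :
    scale r (single m j x) = single m j (r • x) :=
  Finsupp.smul_single _ _ _

variable [Monoid M]

theorem commute_scale_translate (r : R) (m : M) :
    Commute (scale r : AddMonoid.End (Ind M J N)) (translate m) :=
  hom_ext fun m' j x => by
    change scale r (translate m (single m' j x)) = translate m (scale r (single m' j x))
    rw [translate_single, scale_single, scale_single, translate_single]

noncomputable instance : Module (MonoidAlgebra R M) (Ind M J N) :=
  Module.compHom _ (MonoidAlgebra.liftNCRingHom (scale (M := M) (J := J) (N := N) (R := R))
    translate commute_scale_translate)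

theorem single_smul_single (m m' : M) (r : R) (j : J) (x : N) :
    MonoidAlgebra.single m r • (single m' j x : Ind M J N) = single (m * m') j (r • x) := by
  change (MonoidAlgebra.liftNCRingHom (scale (M := M) (J := J) (N := N) (R := R))
    translate commute_scale_translate) (MonoidAlgebra.single m r) (single m' j x) = _
  rw [MonoidAlgebra.liftNCRingHom_single]
  change scale r (translate m (single m' j x)) = _
  rw [translate_single, scale_single]

end Ind

section Linear

variable {R : Type u} [Ring R] [Monoid M] [Module R N] {Y Z : Type u} [AddCommGroup Y]
  [Module (MonoidAlgebra R M) Y] [AddCommGroup Z] [Module (MonoidAlgebra R M) Z]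

/-- An additive map out of `Ind M J N` commuting with monomials, as a linear map. -/
def Ind.toLinearMap (f : Ind M J N →+ Y)
    (h : ∀ (m : M) (r : R) (m' : M) (j : J) (x : N),
      f (Ind.single (m * m') j (r • x)) = MonoidAlgebra.single m r • f (Ind.single m' j x)) :
    Ind M J N →ₗ[MonoidAlgebra R M] Y :=
  { f with
    map_smul' := fun a y => by
      change f (a • y) = a • f y
      induction a using MonoidAlgebra.induction_linear with
      | zero => rw [zero_smul, zero_smul, map_zero]
      | add a b ha hb => rw [add_smul, map_add, ha, hb, add_smul]
      | single m r =>
        induction y using Ind.induction with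
        | zero => rw [smul_zero, map_zero, smul_zero]
        | add a b ha hb => rw [smul_add, map_add, ha, hb, map_add, smul_add]
        | single m' j x => rw [Ind.single_smul_single, h] }

/-- The linear map out of an induced module determined by `R`-linear maps. -/
noncomputable def Ind.linearLift (f : J → N →+ Y)
    (hf : ∀ j (r : R) x, f j (r • x) = MonoidAlgebra.single (1 : M) r • f j x) :
    Ind M J N →ₗ[MonoidAlgebra R M] Y :=
  Ind.toLinearMap
    (Ind.lift fun m j => (DistribSMul.toAddMonoidHom Y (MonoidAlgebra.single m (1 : R))).comp (f j))
    fun m r m' j x => by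
      simp only [Ind.lift_single, AddMonoidHom.comp_apply, DistribSMul.toAddMonoidHom_apply, hf,
        smul_smul, MonoidAlgebra.single_mul_single, one_mul, mul_one]

theorem Ind.linearLift_single (f : J → N →+ Y)
    (hf : ∀ j (r : R) x, f j (r • x) = MonoidAlgebra.single (1 : M) r • f j x) (m : M) (j : J)
    (x : N) : Ind.linearLift f hf (Ind.single m j x) = MonoidAlgebra.single m (1 : R) • f j x :=
  Ind.lift_single
    (fun m j => (DistribSMul.toAddMonoidHom Y (MonoidAlgebra.single m (1 : R))).comp (f j)) m j x

theorem exists_semilinear_lift [Module.Projective R N] (g : Y →ₗ[MonoidAlgebra R M] Z)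
    (hg : Function.Surjective g) (f : N →+ Z)
    (hf : ∀ (r : R) x, f (r • x) = MonoidAlgebra.single (1 : M) r • f x) :
    ∃ f' : N →+ Y, (∀ (r : R) x, f' (r • x) = MonoidAlgebra.single (1 : M) r • f' x) ∧
      ∀ x, g (f' x) = f x := by
  let : Module R Y := Module.compHom Y (MonoidAlgebra.singleOneRingHom : R →+* MonoidAlgebra R M)
  let : Module R Z := Module.compHom Z (MonoidAlgebra.singleOneRingHom : R →+* MonoidAlgebra R M)
  obtain ⟨h, hh⟩ := Module.projective_lifting_property (R := R)
    ({ g with map_smul' := fun r y => map_smul g (MonoidAlgebra.single 1 r) y } : Y →ₗ[R] Z)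
    ({ f with map_smul' := hf } : N →ₗ[R] Z) hg
  exact ⟨h.toAddMonoidHom, fun r x => map_smul h r x, fun x => LinearMap.congr_fun hh x⟩

instance Ind.projective [Module.Projective R N] :
    Module.Projective (MonoidAlgebra R M) (Ind M J N) := by
  refine Module.Projective.of_lifting_property'' fun g hg => ?_
  choose f hf hgf using fun j : J => exists_semilinear_lift g hg (Ind.single 1 j : N →+ Ind M J N)
    fun r x => by rw [Ind.single_smul_single, one_mul]
  refine ⟨Ind.linearLift f hf, LinearMap.toAddMonoidHom_injective (Ind.hom_ext fun m j x => ?_)⟩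
  simp [Ind.linearLift_single, hgf, Ind.single_smul_single]

variable {Q : Type u} [AddCommGroup Q] [Module R Q]

/-- Functoriality of the induced module, on underlying additive groups. -/
noncomputable def Ind.mapAddHom (M J : Type u) (f : N →ₗ[R] Q) : Ind M J N →+ Ind M J Q :=
  Finsupp.mapRange.addMonoidHom f.toAddMonoidHom

omit [Monoid M] in
theorem Ind.mapAddHom_single (f : N →ₗ[R] Q) (m : M) (j : J) (x : N) :
    Ind.mapAddHom M J f (Ind.single m j x) = Ind.single m j (f x) :=
  Finsupp.mapRange_single (hf := map_zero f)

/-- Functoriality of the induced module. -/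
noncomputable def Ind.map (f : N →ₗ[R] Q) : Ind M J N →ₗ[MonoidAlgebra R M] Ind M J Q :=
  Ind.toLinearMap (Ind.mapAddHom M J f) fun m r m' j x => by
    rw [Ind.mapAddHom_single, Ind.mapAddHom_single, Ind.single_smul_single, map_smul]

theorem PdLT.ind (n : ℕ) : ∀ (N : Type u) [AddCommGroup N] [Module R N], PdLT R N n →
    PdLT (MonoidAlgebra R M) (Ind M J N) n := by
  induction n with
  | zero =>
    intro N _ _ h
    rw [pdLT_zero_iff] at h ⊢
    exact inferInstanceAs (Subsingleton (M × J →₀ N))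
  | succ n ih =>
    intro N _ _ hN
    cases n with
    | zero =>
      rw [zero_add, pdLT_one_iff] at hN ⊢
      infer_instance
    | succ n =>
      let g := Finsupp.linearCombination R (id : N → N)
      have hg := surjective_linearCombination_id R N
      have hK := ih _ (PdLT.ker hg (PdLT.of_projective n) hN)
      refine PdLT.right (f := Ind.map (LinearMap.ker g).subtype) (g := Ind.map g)
        (Finsupp.mapRange_injective _ (map_zero _) (LinearMap.ker g).injective_subtype)
        (fun x => ⟨fun hx => ?_, ?_⟩) (Finsupp.mapRange_surjective _ (map_zero _) hg) hK
        (PdLT.of_projective _)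
      · classical
        let r (y : N →₀ R) : LinearMap.ker g := if h : g y = 0 then ⟨y, h⟩ else 0
        have hr : ∀ y, g y = 0 → (r y).1 = y := fun y hy => by simp [r, hy]
        refine ⟨Finsupp.mapRange r (Subtype.ext (hr 0 (map_zero g))) x, ?_⟩
        exact Finsupp.ext fun p => hr _ (DFunLike.congr_fun (F := M × J →₀ N) hx p)
      · rintro ⟨y, rfl⟩
        exact Finsupp.ext fun p => ((show M × J →₀ LinearMap.ker g from y) p).2

end Linear

end Induced

namespace TraceMonoid

variable {E : Type u} {I : E → E → Prop}

theorem of_mul_of_comm {a b : E} (h : I a b) : of E I a * of E I b = of E I b * of E I a :=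
  (Con.eq _).2 (ConGen.Rel.of _ _ ⟨a, b, h, rfl, rfl⟩)

/-- The universal property of the trace monoid. -/
def lift {N : Type*} [Monoid N] (f : E → N) (h : ∀ a b, I a b → f a * f b = f b * f a) :
    TraceMonoid E I →* N :=
  Con.lift (traceCon E I) (FreeMonoid.lift f) (Con.conGen_le.2 (by
    rintro _ _ ⟨a, b, hab, rfl, rfl⟩
    change FreeMonoid.lift f _ = FreeMonoid.lift f _
    simp [h a b hab]))

@[simp]
theorem lift_of {N : Type*} [Monoid N] (f : E → N) (h : ∀ a b, I a b → f a * f b = f b * f a)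
    (a : E) : lift f h (of E I a) = f a :=
  FreeMonoid.lift_eval_of f a

@[elab_as_elim]
theorem induction_of_mul {p : TraceMonoid E I → Prop} (w : TraceMonoid E I) (one : p 1)
    (of_mul : ∀ a w, p w → p (of E I a * w)) : p w := by
  obtain ⟨x, rfl⟩ := Con.mk'_surjective w
  induction x using FreeMonoid.inductionOn' with
  | one => exact one
  | of_mul a x ih => exact of_mul a _ ih

theorem closure_range_of : Submonoid.closure (Set.range (of E I)) = ⊤ :=
  top_unique fun w _ => w.induction_of_mul (one_mem _) fun a _ hw =>
    mul_mem (Submonoid.subset_closure ⟨a, rfl⟩) hw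

@[elab_as_elim]
theorem induction_mul_of {p : TraceMonoid E I → Prop} (w : TraceMonoid E I) (one : p 1)
    (mul_of : ∀ w a, p w → p (w * of E I a)) : p w :=
  Submonoid.induction_of_closure_eq_top_right closure_range_of w one (by
    rintro w _ ⟨a, rfl⟩
    exact mul_of w a)

theorem exists_eq_mul_of {w : TraceMonoid E I} (hw : w ≠ 1) : ∃ v a, w = v * of E I a := by
  induction w using induction_mul_of with
  | one => exact absurd rfl hw
  | mul_of v a => exact ⟨v, a, rfl⟩

/-- The length of a trace. -/
def length (w : TraceMonoid E I) : ℕ :=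
  (lift (fun _ => Multiplicative.ofAdd 1) (fun _ _ _ => rfl) w : Multiplicative ℕ).toAdd

@[simp]
theorem length_one : length (1 : TraceMonoid E I) = 0 := by simp [length]

@[simp]
theorem length_mul_of (w : TraceMonoid E I) (a : E) : length (w * of E I a) = length w + 1 := by
  simp [length]

section Rem

variable [Std.Irrefl I] [Std.Symm I]

open Classical in
/-- Multiplying a pair `(w, r)` on the right by the letter `b`, where `r` is the right quotient of
`w` by the letter `a`. -/
noncomputable def remStep (a b : E) (p : TraceMonoid E I × Option (TraceMonoid E I)) :
    TraceMonoid E I × Option (TraceMonoid E I) :=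
  (p.1 * of E I b,
    if b = a then some p.1 else if I a b then p.2.map (· * of E I b) else none)

theorem remStep_comm (a : E) {b c : E} (h : I b c)
    (p : TraceMonoid E I × Option (TraceMonoid E I)) :
    remStep a b (remStep a c p) = remStep a c (remStep a b p) := by
  obtain ⟨w, r⟩ := p
  have hbc : b ≠ c := fun e => irrefl_of I b (e ▸ h : I b b)
  have h1 : ∀ v, v * of E I b * of E I c = v * of E I c * of E I b := fun v => by
    rw [mul_assoc, of_mul_of_comm h, mul_assoc]
  have h' := symm_of I h
  by_cases hb : b = a
  · subst hb
    simp [remStep, h1, h, hbc.symm]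
  · by_cases hc : c = a
    · subst hc
      simp [remStep, h1, h', hbc]
    · cases r <;> by_cases I a b <;> by_cases I a c <;> simp [remStep, *]

/-- The right action of the trace monoid through `remStep`. -/
noncomputable def remHom (a : E) :
    TraceMonoid E I →* (Function.End (TraceMonoid E I × Option (TraceMonoid E I)))ᵐᵒᵖ :=
  lift (fun b => MulOpposite.op (remStep a b)) fun _ _ h =>
    congrArg MulOpposite.op (funext fun p => (remStep_comm a h p).symm)

/-- The right quotient of a trace by a letter, if it exists. -/
noncomputable def rem (a : E) (w : TraceMonoid E I) : Option (TraceMonoid E I) :=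
  ((remHom a w).unop (1, none)).2

theorem remHom_mul_of (a b : E) (w : TraceMonoid E I) :
    (remHom a (w * of E I b)).unop (1, none) = remStep a b ((remHom a w).unop (1, none)) := by
  rw [map_mul, MulOpposite.unop_mul, remHom, lift_of]
  rfl

theorem remHom_apply_fst (a : E) (w : TraceMonoid E I) :
    ((remHom a w).unop (1, none)).1 = w := by
  induction w using induction_mul_of with
  | one => rw [map_one]; rfl
  | mul_of w b ih => rw [remHom_mul_of, remStep, ih]

theorem rem_one (a : E) : rem a (1 : TraceMonoid E I) = none := by
  rw [rem, map_one]
  rfl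

open Classical in
theorem rem_mul_of (a b : E) (w : TraceMonoid E I) : rem a (w * of E I b) =
    if b = a then some w else if I a b then (rem a w).map (· * of E I b) else none := by
  rw [rem, remHom_mul_of, remStep, remHom_apply_fst, rem]

@[simp]
theorem rem_mul_of_self (a : E) (w : TraceMonoid E I) : rem a (w * of E I a) = some w := by
  rw [rem_mul_of, if_pos rfl]

theorem eq_mul_of_of_rem_eq_some {a : E} {w : TraceMonoid E I} :
    ∀ {v : TraceMonoid E I}, rem a w = some v → w = v * of E I a := by
  induction w using induction_mul_of with
  | one => simp [rem_one]
  | mul_of w b ih =>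
    intro v h
    rw [rem_mul_of] at h
    split_ifs at h with hb hab
    · rw [← Option.some.inj h, hb]
    · obtain ⟨t, ht, rfl⟩ := Option.map_eq_some_iff.1 h
      rw [ih ht, mul_assoc, mul_assoc, of_mul_of_comm hab]

theorem mul_of_injective (a : E) : Function.Injective (· * of E I a) := fun u v h =>
  Option.some.inj ((rem_mul_of_self a u).symm.trans ((congrArg (rem a) h).trans
    (rem_mul_of_self a v)))

/-- Reversal of traces. -/
def reverse (E : Type u) (I : E → E → Prop) : TraceMonoid E I →* (TraceMonoid E I)ᵐᵒᵖ :=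
  lift (fun a => MulOpposite.op (of E I a)) fun _ _ h =>
    congrArg MulOpposite.op (of_mul_of_comm h).symm

omit [Std.Irrefl I] [Std.Symm I] in
theorem reverse_reverse (w : TraceMonoid E I) :
    (reverse E I (reverse E I w).unop).unop = w := by
  induction w using induction_mul_of with
  | one => simp
  | mul_of w a ih => simp [reverse] at ih ⊢; simp [ih]

instance : IsLeftCancelMul (TraceMonoid E I) where
  mul_left_cancel w u v h := by
    change w * u = w * v at h
    induction w using induction_of_mul with
    | one => simpa using h
    | of_mul a w ih =>
      refine ih ?_
      rw [mul_assoc, mul_assoc] at h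
      have h2 := congrArg (fun x => (reverse E I x).unop) h
      have h3 : (reverse E I (of E I a)).unop = of E I a := by simp [reverse]
      simp only [map_mul (reverse E I) (of E I a), MulOpposite.unop_mul, h3] at h2
      rw [← reverse_reverse (w * u), ← reverse_reverse (w * v)]
      rw [mul_of_injective a h2]

end Rem

section Height

variable [Std.Irrefl I] [Std.Symm I]

open Classical in
/-- The effect on the multiplicity of the initial letter `a` of multiplying by `b` on the left. -/
noncomputable def heightStep (I : E → E → Prop) (a b : E) : Function.End ℕ := fun n =>
  if b = a then n + 1 else if I b a then n else 0

theorem heightStep_comm (a : E) {b c : E} (h : I b c) :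
    heightStep I a b * heightStep I a c = heightStep I a c * heightStep I a b := by
  refine funext fun n => ?_
  have hbc : b ≠ c := fun e => irrefl_of I b (e ▸ h : I b b)
  have h' := symm_of I h
  change heightStep I a b (heightStep I a c n) = heightStep I a c (heightStep I a b n)
  by_cases hb : b = a
  · subst hb
    simp [heightStep, h', hbc.symm]
  · by_cases hc : c = a
    · subst hc
      simp [heightStep, h, hbc]
    · by_cases I b a <;> by_cases I c a <;> simp [heightStep, *]

/-- The action of the trace monoid through `heightStep`. -/
noncomputable def heightHom (a : E) : TraceMonoid E I →* Function.End ℕ :=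
  lift (heightStep I a) fun _ _ => heightStep_comm a

/-- The largest `n` such that `a ^ n` divides a given trace on the left. -/
noncomputable def height (a : E) (w : TraceMonoid E I) : ℕ := heightHom a w 0

theorem height_one (a : E) : height a (1 : TraceMonoid E I) = 0 := by
  rw [height, map_one]
  rfl

theorem height_of_mul (a b : E) (w : TraceMonoid E I) :
    height a (of E I b * w) = heightStep I a b (height a w) := by
  rw [height, map_mul]
  change heightHom a (of E I b) (heightHom a w 0) = _
  rw [heightHom, lift_of]
  rfl

theorem height_of_mul_self (a : E) (w : TraceMonoid E I) :
    height a (of E I a * w) = height a w + 1 := by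
  rw [height_of_mul, heightStep, if_pos rfl]

theorem height_of_mul_of_rel {a b : E} (h : I b a) (w : TraceMonoid E I) :
    height a (of E I b * w) = height a w := by
  have hba : b ≠ a := fun e => irrefl_of I b (e ▸ h : I b b)
  rw [height_of_mul, heightStep, if_neg hba, if_pos h]

theorem exists_eq_of_mul (a : E) (w : TraceMonoid E I) (hw : height a w ≠ 0) :
    ∃ v, w = of E I a * v := by
  induction w using induction_of_mul with
  | one => exact absurd (height_one a) hw
  | of_mul b w ih =>
    by_cases hb : b = a
    · exact ⟨w, by rw [hb]⟩
    · by_cases hba : I b a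
      · rw [height_of_mul_of_rel hba] at hw
        obtain ⟨v, rfl⟩ := ih hw
        exact ⟨of E I b * v, by rw [← mul_assoc, of_mul_of_comm hba, mul_assoc]⟩
      · rw [height_of_mul, heightStep, if_neg hb, if_neg hba] at hw
        exact absurd rfl hw

end Height

section Clique

open Classical in
/-- The product of the letters of a clique (and `1` for any other finite set). -/
noncomputable def cliqueProd (I : E → E → Prop) (c : Finset E) : TraceMonoid E I :=
  if h : (c : Set E).Pairwise I then
    c.noncommProd (of E I) (h.imp fun _ _ => of_mul_of_comm)
  else 1

theorem cliqueProd_empty : cliqueProd I ∅ = 1 := by simp [cliqueProd]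

theorem cliqueProd_insert [DecidableEq E] {c : Finset E} {a : E} (ha : a ∉ c)
    (h : ((insert a c : Finset E) : Set E).Pairwise I) :
    cliqueProd I (insert a c) = cliqueProd I c * of E I a := by
  have hc : (c : Set E).Pairwise I := h.mono (by simp)
  rw [cliqueProd, cliqueProd, dif_pos h, dif_pos hc]
  convert Finset.noncommProd_insert_of_notMem' c a (of E I) _ ha

theorem of_mul_cliqueProd_erase [DecidableEq E] {c : Finset E} {a : E} (ha : a ∈ c)
    (h : (c : Set E).Pairwise I) : of E I a * cliqueProd I (c.erase a) = cliqueProd I c := by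
  have hc : ((c.erase a : Finset E) : Set E).Pairwise I := h.mono (by simp)
  rw [cliqueProd, cliqueProd, dif_pos h, dif_pos hc]
  exact Finset.mul_noncommProd_erase c ha (of E I) _

variable [Std.Irrefl I] [Std.Symm I]

theorem of_rem_mul_cliqueProd {c : Finset E} (hc : (c : Set E).Pairwise I) {a : E} (ha : a ∉ c)
    {m : TraceMonoid E I} : ∀ {v : TraceMonoid E I}, rem a (m * cliqueProd I c) = some v →
      (∀ b ∈ c, I a b) ∧ ∃ m', rem a m = some m' := by
  classical
  induction c using Finset.induction_on with
  | empty =>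
    intro v hv
    rw [cliqueProd_empty, mul_one] at hv
    exact ⟨by simp, v, hv⟩
  | insert b c hb ih =>
    intro v hv
    have hba : b ≠ a := fun e => ha (e ▸ Finset.mem_insert_self b c)
    rw [cliqueProd_insert hb hc, ← mul_assoc, rem_mul_of, if_neg hba] at hv
    split_ifs at hv with hab
    obtain ⟨t, ht, -⟩ := Option.map_eq_some_iff.1 hv
    obtain ⟨h1, h2⟩ := ih (hc.mono (by simp)) (fun h => ha (Finset.mem_insert_of_mem h)) ht
    exact ⟨by simpa [hab] using h1, h2⟩

end Clique

end TraceMonoid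

section LowerBound

theorem projective_monoidAlgebra_of_factorization (R : Type u) [Ring R] {Q M : Type*} [Monoid Q]
    [Monoid M] (φ : Q →* M) (ψ : M → Q) (τ : M → M) (h : ∀ w, φ (ψ w) * τ w = w)
    (hψ : ∀ q w, ψ (φ q * w) = q * ψ w) (hτ : ∀ q w, τ (φ q * w) = τ w) :
    @Module.Projective (MonoidAlgebra R Q) _ (MonoidAlgebra R M) _
      (Module.compHom _ (MonoidAlgebra.mapDomainRingHom R φ)) := by
  let := Module.compHom (MonoidAlgebra R M) (MonoidAlgebra.mapDomainRingHom R φ)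
  have hsmul : ∀ (q : Q) (r : R) (x : MonoidAlgebra R M),
      MonoidAlgebra.single q r • x = MonoidAlgebra.single (φ q) r * x := fun q r x =>
    congrArg (· * x) (MonoidAlgebra.mapDomain_single (f := φ) (a := q) (r := r))
  let s : MonoidAlgebra R M →+ (M →₀ MonoidAlgebra R Q) :=
    (Finsupp.liftAddHom fun w =>
      (Finsupp.singleAddHom (τ w)).comp (MonoidAlgebra.singleAddHom (ψ w))).comp
      MonoidAlgebra.coeffAddEquiv.toAddMonoidHom
  have hs : ∀ w r, s (MonoidAlgebra.single w r) =
      Finsupp.single (τ w) (MonoidAlgebra.single (ψ w) r) := fun w r => by simp [s]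
  refine Module.Projective.of_split (M := M →₀ MonoidAlgebra R Q)
    { s with
      map_smul' := fun a x => ?_ }
    (Finsupp.linearCombination (MonoidAlgebra R Q) fun w => MonoidAlgebra.single w (1 : R))
    (LinearMap.ext fun x => ?_)
  · change s (a • x) = a • s x
    induction a using MonoidAlgebra.induction_linear with
    | zero => rw [zero_smul, zero_smul, map_zero]
    | add a b ha hb => rw [add_smul, map_add, ha, hb, add_smul]
    | single q r =>
      induction x using MonoidAlgebra.induction_linear with
      | zero => rw [smul_zero, map_zero, smul_zero]
      | add a b ha hb => rw [smul_add, map_add, ha, hb, map_add, smul_add]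
      | single w r' =>
        rw [hsmul, MonoidAlgebra.single_mul_single, hs, hs, hψ, hτ, Finsupp.smul_single,
          smul_eq_mul, MonoidAlgebra.single_mul_single]
  · change Finsupp.linearCombination _ _ (s x) = x
    induction x using MonoidAlgebra.induction_linear with
    | zero => rw [map_zero, map_zero]
    | add a b ha hb => rw [map_add, map_add, ha, hb]
    | single w r =>
      rw [hs, Finsupp.linearCombination_single, hsmul, MonoidAlgebra.single_mul_single, h, mul_one]

theorem GldLT.of_monoidAlgebra_pi_nat {R : Type u} [Ring R] {n : ℕ} (k : ℕ)
    (h : GldLT (MonoidAlgebra R (Fin k → Multiplicative ℕ)) (n + k)) : GldLT R n := by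
  induction k with
  | zero => exact h.of_ringEquiv (MonoidAlgebra.uniqueRingEquiv _).symm
  | succ k ih =>
    let e : (Fin (k + 1) → Multiplicative ℕ) ≃* Multiplicative ℕ × (Fin k → Multiplicative ℕ) :=
      { (Fin.consEquiv fun _ => Multiplicative ℕ).symm with map_mul' := fun _ _ => rfl }
    refine ih (GldLT.of_polynomial (h.of_ringEquiv ?_))
    exact (((MonoidAlgebra.mapDomainRingEquiv R e).trans MonoidAlgebra.curryRingEquiv).trans
      (AddMonoidAlgebra.toMultiplicative _ ℕ).symm).trans
      (Polynomial.toFinsuppIso _).symm |>.symm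

namespace TraceMonoid

variable {E : Type u} {I : E → E → Prop} [Std.Irrefl I] [Std.Symm I] {k : ℕ}

/-- The submonoid spanned by a family of commuting letters, as a homomorphism from `ℕ ^ k`. -/
noncomputable def cliqueHom (f : Fin k → E) (hf : Pairwise fun i j => I (f i) (f j)) :
    (Fin k → Multiplicative ℕ) →* TraceMonoid E I :=
  MonoidHom.noncommPiCoprod (fun i => powersHom _ (of E I (f i))) fun i j hij x y =>
    (show Commute (of E I (f i)) (of E I (f j)) from of_mul_of_comm (hf hij)).pow_pow
      x.toAdd y.toAdd

/-- The retraction of a trace monoid onto the submonoid spanned by a family of letters. -/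
noncomputable def cliqueRetraction (f : Fin k → E) (I : E → E → Prop) :
    TraceMonoid E I →* (Fin k → Multiplicative ℕ) := by
  classical
  exact lift (fun a i => if f i = a then Multiplicative.ofAdd 1 else 1) fun _ _ _ => mul_comm _ _

/-- The heights of a trace with respect to a family of letters. -/
noncomputable def heights (f : Fin k → E) (w : TraceMonoid E I) : Fin k → Multiplicative ℕ :=
  fun i => Multiplicative.ofAdd (height (f i) w)

variable (f : Fin k → E) (hf : Pairwise fun i j => I (f i) (f j))

omit [Std.Irrefl I] [Std.Symm I] in
theorem cliqueHom_mulSingle (i : Fin k) :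
    cliqueHom f hf (Pi.mulSingle i (Multiplicative.ofAdd 1)) = of E I (f i) := by
  exact (MonoidHom.noncommPiCoprod_mulSingle (fun i => powersHom _ (of E I (f i))) i _).trans
    ((powersHom_apply _ _).trans (pow_one _))

@[elab_as_elim]
theorem pi_nat_induction {p : (Fin k → Multiplicative ℕ) → Prop} (one : p 1)
    (mul : ∀ (i : Fin k) q, p q → p (Pi.mulSingle i (Multiplicative.ofAdd 1) * q))
    (q : Fin k → Multiplicative ℕ) : p q := by
  have key : ∀ (i : Fin k) (n : ℕ) q, p q → p (Pi.mulSingle i (Multiplicative.ofAdd n) * q) := by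
    intro i n
    induction n with
    | zero => intro q hq; simpa using hq
    | succ n ih =>
      intro q hq
      rw [add_comm, ofAdd_add, Pi.mulSingle_mul, mul_assoc]
      exact mul i _ (ih q hq)
  suffices ∀ r, p r → p (q * r) by simpa using this 1 one
  induction q using Pi.mulSingle_induction with
  | one => simp
  | mul f g hf hg => exact fun r hr => mul_assoc f g r ▸ hf _ (hg r hr)
  | mulSingle i m => exact key i m.toAdd

include hf in
omit [Std.Symm I] in
theorem injective_of_pairwise_rel : Function.Injective f := fun i j h => by
  by_contra hij
  exact irrefl_of I (f i) (by simpa [h] using hf hij)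

include hf in
theorem heights_of_mul (i : Fin k) (w : TraceMonoid E I) :
    heights f (of E I (f i) * w) =
      Pi.mulSingle i (Multiplicative.ofAdd 1) * heights f w := by
  funext j
  by_cases hij : i = j
  · subst hij
    simp [heights, height_of_mul_self, add_comm]
  · simp [heights, height_of_mul_of_rel (hf hij), Pi.mulSingle_eq_of_ne' hij]

theorem heights_cliqueHom_mul (q : Fin k → Multiplicative ℕ) (w : TraceMonoid E I) :
    heights f (cliqueHom f hf q * w) = q * heights f w := by
  induction q using pi_nat_induction with
  | one => rw [map_one, one_mul, one_mul]
  | mul i q ih => rw [map_mul, cliqueHom_mulSingle, mul_assoc, heights_of_mul f hf, ih, mul_assoc]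

omit [Std.Symm I] in
theorem cliqueRetraction_cliqueHom (q : Fin k → Multiplicative ℕ) :
    cliqueRetraction f I (cliqueHom f hf q) = q := by
  classical
  induction q using pi_nat_induction with
  | one => rw [map_one, map_one]
  | mul i q ih =>
    rw [map_mul, map_mul, ih, cliqueHom_mulSingle, cliqueRetraction, lift_of]
    congr 1
    funext j
    simp [(injective_of_pairwise_rel f hf).eq_iff, Pi.mulSingle_apply]

theorem exists_cliqueHom_heights_mul_eq (w : TraceMonoid E I) :
    ∃ t, cliqueHom f hf (heights f w) * t = w := by
  induction hn : w.length using Nat.strong_induction_on generalizing w with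
  | h n ih =>
    by_cases h : ∀ i, height (f i) w = 0
    · refine ⟨w, ?_⟩
      have : heights f w = 1 := funext fun i => congrArg Multiplicative.ofAdd (h i)
      rw [this, map_one, one_mul]
    · push Not at h
      obtain ⟨i, hi⟩ := h
      obtain ⟨v, rfl⟩ := exists_eq_of_mul _ _ hi
      obtain ⟨t, ht⟩ := ih v.length (by simp [← hn, length]) v rfl
      exact ⟨t, by rw [heights_of_mul f hf, map_mul, cliqueHom_mulSingle, mul_assoc, ht]⟩

include hf in
theorem gldLT_of_clique {R : Type u} [Ring R] {n : ℕ}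
    (h : GldLT (MonoidAlgebra R (TraceMonoid E I)) (n + k)) : GldLT R n := by
  choose t ht using exists_cliqueHom_heights_mul_eq f hf
  refine GldLT.of_monoidAlgebra_pi_nat k (h.of_ringHom
    (MonoidAlgebra.mapDomainRingHom R (cliqueHom f hf))
    (projective_monoidAlgebra_of_factorization R (cliqueHom f hf) (heights f) t ht
      (heights_cliqueHom_mul f hf) fun q w => ?_)
    (MonoidAlgebra.mapDomainRingHom R (cliqueRetraction f I)) fun b => ?_)
  · have := ht (cliqueHom f hf q * w)
    rw [heights_cliqueHom_mul, map_mul, mul_assoc] at this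
    exact mul_left_cancel ((mul_left_cancel this).trans (ht w).symm)
  · rw [← RingHom.comp_apply, ← MonoidAlgebra.mapDomainRingHom_comp]
    have : (cliqueRetraction f I).comp (cliqueHom f hf) = MonoidHom.id _ :=
      MonoidHom.ext (cliqueRetraction_cliqueHom f hf)
    rw [this, MonoidAlgebra.mapDomainRingHom_id, RingHom.id_apply]

end TraceMonoid

end LowerBound

section Supported

variable {M J N : Type u} [AddCommGroup N]

namespace Ind

/-- The elements of `Ind M J N` supported on the pairs satisfying `P`. -/
noncomputable def supported (N : Type u) [AddCommGroup N] (P : M → J → Prop) :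
    AddSubgroup (Ind M J N) :=
  AddSubgroup.closure {y | ∃ m j x, P m j ∧ single m j x = y}

variable {P P' : M → J → Prop}

theorem single_mem_supported {m : M} {j : J} (h : P m j) (x : N) :
    single m j x ∈ supported N P :=
  AddSubgroup.subset_closure ⟨m, j, x, h, rfl⟩

theorem map_mem_of_supported {Y : Type*} [AddCommGroup Y] (f : Ind M J N →+ Y) (S : AddSubgroup Y)
    (h : ∀ m j, P m j → ∀ x, f (single m j x) ∈ S) {y : Ind M J N} (hy : y ∈ supported N P) :
    f y ∈ S := by
  have : supported N P ≤ S.comap f := (AddSubgroup.closure_le _).2 (by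
    rintro _ ⟨m, j, x, hp, rfl⟩
    exact h m j hp x)
  exact this hy

theorem map_eq_zero_of_supported {Y : Type*} [AddCommGroup Y] (f : Ind M J N →+ Y)
    (h : ∀ m j, P m j → ∀ x, f (single m j x) = 0) {y : Ind M J N} (hy : y ∈ supported N P) :
    f y = 0 :=
  map_mem_of_supported f ⊥ h hy

theorem supported_mono (h : ∀ m j, P m j → P' m j) : supported N P ≤ supported N P' :=
  fun _ => map_mem_of_supported (AddMonoidHom.id _) _ fun m j hp => single_mem_supported (h m j hp)

theorem exists_mem_supported_lt (wt : M → J → ℕ) {y : Ind M J N} (hy : y ∈ supported N P) :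
    ∃ L, y ∈ supported N fun m j => P m j ∧ wt m j < L := by
  induction hy using AddSubgroup.closure_induction with
  | mem y hy =>
    obtain ⟨m, j, x, hp, rfl⟩ := hy
    exact ⟨wt m j + 1, single_mem_supported ⟨hp, Nat.lt_succ_self _⟩ x⟩
  | zero => exact ⟨0, zero_mem _⟩
  | neg y _ ih =>
    obtain ⟨L, hL⟩ := ih
    exact ⟨L, neg_mem hL⟩
  | add y z _ _ hy hz =>
    obtain ⟨L, hL⟩ := hy
    obtain ⟨L', hL'⟩ := hz
    refine ⟨max L L', add_mem (supported_mono (fun m j h => ⟨h.1, ?_⟩) hL)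
      (supported_mono (fun m j h => ⟨h.1, ?_⟩) hL')⟩
    · exact h.2.trans_le (le_max_left _ _)
    · exact h.2.trans_le (le_max_right _ _)

variable {R : Type u} [Ring R] [Monoid M] [Module R N]

/-- The submodule of `Ind M J N` spanned by the copies indexed by `P`. -/
noncomputable def supportedSubmodule (R M N : Type u) [Ring R] [Monoid M] [AddCommGroup N]
    [Module R N] (P : J → Prop) : Submodule (MonoidAlgebra R M) (Ind M J N) :=
  { supported N fun _ j => P j with
    smul_mem' := fun a y hy => by
      change a • y ∈ supported N fun _ j => P j
      induction a using MonoidAlgebra.induction_linear with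
      | zero => rw [zero_smul]; exact zero_mem _
      | add a b ha hb => rw [add_smul]; exact add_mem ha hb
      | single m r =>
        refine map_mem_of_supported
          (DistribSMul.toAddMonoidHom (Ind M J N) (MonoidAlgebra.single m r)) _
          (fun m' j hp x => ?_) hy
        rw [DistribSMul.toAddMonoidHom_apply, single_smul_single]
        exact single_mem_supported hp _ }

open Classical in
/-- The projection of `Ind M J N` onto the copies indexed by `P`. -/
noncomputable def project (R M N : Type u) [Ring R] [Monoid M] [AddCommGroup N] [Module R N]
    (P : J → Prop) : Ind M J N →ₗ[MonoidAlgebra R M] Ind M J N :=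
  toLinearMap (lift fun m j => if P j then single m j else 0) fun m r m' j x => by
    by_cases h : P j <;> simp [h, single_smul_single]

open Classical in
theorem project_single (P : J → Prop) (m : M) (j : J) (x : N) :
    project R M N P (single m j x) = if P j then single m j x else 0 := by
  refine (lift_single (fun m j => if P j then single m j else 0) m j x).trans ?_
  split_ifs <;> rfl

theorem pdLT_supportedSubmodule (P : J → Prop) {n : ℕ}
    (h : PdLT (MonoidAlgebra R M) (Ind M J N) n) :
    PdLT (MonoidAlgebra R M) (supportedSubmodule R M N P) n := by
  refine h.of_retract (supportedSubmodule R M N P).subtype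
    ((project R M N P).codRestrict _ fun y => ?_) fun y => Subtype.ext ?_
  · induction y using Ind.induction with
    | zero => rw [map_zero]; exact zero_mem _
    | add a b ha hb => rw [map_add]; exact add_mem ha hb
    | single m j x =>
      rw [project_single]
      split_ifs with hj
      · exact single_mem_supported hj x
      · exact zero_mem _
  · refine sub_eq_zero.1 (map_eq_zero_of_supported
      ((project R M N P).toAddMonoidHom - AddMonoidHom.id _) (fun m j hj x => ?_) y.2)
    refine sub_eq_zero.2 ((project_single (R := R) P m j x).trans (if_pos hj))

end Ind

end Supported

section Sign

variable {E : Type u} [LinearOrder E]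

/-- The sign of a letter in a clique. -/
def koszulSign (a : E) (c : Finset E) : ℤ := (-1) ^ (c.filter (· < a)).card

theorem koszulSign_mul_self (a : E) (c : Finset E) : koszulSign a c * koszulSign a c = 1 := by
  rw [koszulSign, ← pow_add, ← two_mul, pow_mul, neg_one_sq, one_pow]

theorem koszulSign_erase_of_lt {a b : E} {c : Finset E} (hb : b ∈ c) (h : b < a) :
    koszulSign a (c.erase b) = -koszulSign a c := by
  have hb' : b ∈ c.filter (· < a) := Finset.mem_filter.2 ⟨hb, h⟩
  rw [koszulSign, koszulSign, Finset.filter_erase, ← Finset.card_erase_add_one hb', pow_succ]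
  ring

theorem koszulSign_erase_of_not_lt {a b : E} (c : Finset E) (h : ¬ b < a) :
    koszulSign a (c.erase b) = koszulSign a c := by
  rw [koszulSign, koszulSign, Finset.filter_erase, Finset.erase_eq_of_notMem (by simp [h])]

theorem koszulSign_mul_erase {a b : E} {c : Finset E} (ha : a ∈ c) (hb : b ∈ c) (hab : a ≠ b) :
    koszulSign a c * koszulSign b (c.erase a) = -(koszulSign b c * koszulSign a (c.erase b)) := by
  rcases lt_or_gt_of_ne hab with h | h
  · rw [koszulSign_erase_of_lt ha h, koszulSign_erase_of_not_lt _ h.not_gt]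
    ring
  · rw [koszulSign_erase_of_lt hb h, koszulSign_erase_of_not_lt _ h.not_gt]
    ring

theorem koszulSign_mul {a b : E} {c : Finset E} (ha : a ∈ c) (hb : b ∈ c) (hab : a ≠ b) :
    koszulSign a c * koszulSign b c =
      -(koszulSign b (c.erase a) * koszulSign a (c.erase b)) := by
  rcases lt_or_gt_of_ne hab with h | h
  · rw [koszulSign_erase_of_lt ha h, koszulSign_erase_of_not_lt _ h.not_gt]
    ring
  · rw [koszulSign_erase_of_lt hb h, koszulSign_erase_of_not_lt _ h.not_gt]
    ring

theorem sum_koszulSign_eq_zero {Y : Type*} [AddCommGroup Y] (c : Finset E) (t : E → E → Y)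
    (ht : ∀ a ∈ c, ∀ b ∈ c, a ≠ b → t a b = t b a) :
    ∑ a ∈ c, koszulSign a c • ∑ b ∈ c.erase a, koszulSign b (c.erase a) • t a b = 0 := by
  simp only [Finset.smul_sum, smul_smul]
  rw [Finset.sum_sigma']
  refine Finset.sum_involution (fun p _ => ⟨p.2, p.1⟩) (fun p hp => ?_) (fun p hp _ h => ?_)
    (fun p hp => ?_) fun p _ => rfl
  · obtain ⟨ha, hba, hb⟩ := by simpa using hp
    rw [ht _ ha _ hb (Ne.symm hba), koszulSign_mul_erase ha hb (Ne.symm hba), neg_smul,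
      neg_add_cancel]
  · obtain ⟨ha, hba, hb⟩ := by simpa using hp
    exact hba (congrArg Sigma.fst h)
  · obtain ⟨ha, hba, hb⟩ := by simpa using hp
    simp [ha, hb, Ne.symm hba]

end Sign

namespace TraceMonoid

section Koszul

variable {E : Type u} {I : E → E → Prop} [LinearOrder E] {R : Type u} [Ring R] {N : Type u}
  [AddCommGroup N]

section Left

/-- The part of the Koszul differential that multiplies the letter into the coefficient. -/
noncomputable def koszulLeft :
    Ind (TraceMonoid E I) (Finset E) N →+ Ind (TraceMonoid E I) (Finset E) N :=
  Ind.lift fun m c => ∑ a ∈ c, koszulSign a c • Ind.single (m * of E I a) (c.erase a)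

theorem koszulLeft_single (m : TraceMonoid E I) (c : Finset E) (x : N) :
    koszulLeft (Ind.single m c x) =
      ∑ a ∈ c, koszulSign a c • Ind.single (m * of E I a) (c.erase a) x := by
  simp [koszulLeft]

open Classical in
/-- A letter in which a trace ends, if it is nontrivial. -/
noncomputable def lastLetter (w : TraceMonoid E I) : Option E :=
  if h : ∃ a v, w = v * of E I a then some h.choose else none

omit [LinearOrder E] in
theorem exists_lastLetter_eq {w : TraceMonoid E I} (hw : w ≠ 1) :
    ∃ a v, lastLetter w = some a ∧ w = v * of E I a := by
  have h : ∃ a v, w = v * of E I a := by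
    obtain ⟨v, a, h⟩ := exists_eq_mul_of hw
    exact ⟨a, v, h⟩
  obtain ⟨v, hv⟩ := h.choose_spec
  exact ⟨_, v, dif_pos h, hv⟩

omit [LinearOrder E] in
theorem lastLetter_one : lastLetter (1 : TraceMonoid E I) = none := by
  refine dif_neg ?_
  rintro ⟨a, v, h⟩
  simpa using congrArg length h

variable [Std.Irrefl I] [Std.Symm I]

/-- The contracting homotopy of the left part of the Koszul differential. -/
noncomputable def koszulHomotopy :
    Ind (TraceMonoid E I) (Finset E) N →+ Ind (TraceMonoid E I) (Finset E) N :=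
  Ind.lift fun m c => (lastLetter (m * cliqueProd I c)).elim 0 fun a =>
    if a ∈ c then 0 else (rem a m).elim 0 fun m' =>
      koszulSign a (insert a c) • Ind.single m' (insert a c)

theorem koszulHomotopy_single_of_mem {m : TraceMonoid E I} {c : Finset E} {a : E}
    (h : lastLetter (m * cliqueProd I c) = some a) (ha : a ∈ c) (x : N) :
    koszulHomotopy (Ind.single m c x) = 0 := by
  simp [koszulHomotopy, h, ha]

theorem koszulHomotopy_single_of_notMem {m : TraceMonoid E I} {c : Finset E} {a : E}
    (h : lastLetter (m * of E I a * cliqueProd I c) = some a) (ha : a ∉ c) (x : N) :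
    koszulHomotopy (Ind.single (m * of E I a) c x) =
      koszulSign a (insert a c) • Ind.single m (insert a c) x := by
  simp [koszulHomotopy, h, ha]

theorem koszulHomotopy_single_of_eq_one {m : TraceMonoid E I} {c : Finset E}
    (h : m * cliqueProd I c = 1) (x : N) : koszulHomotopy (Ind.single m c x) = 0 := by
  simp [koszulHomotopy, h, lastLetter_one]

omit [LinearOrder E] in
theorem exists_lastLetter_mul_cliqueProd_eq {m : TraceMonoid E I} {c : Finset E}
    (hc : (c : Set E).Pairwise I) (h : m * cliqueProd I c ≠ 1) :
    ∃ a, lastLetter (m * cliqueProd I c) = some a ∧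
      (a ∈ c ∨ a ∉ c ∧ (∀ b ∈ c, I a b) ∧ ∃ m', m = m' * of E I a) := by
  obtain ⟨a, v, ha, hv⟩ := exists_lastLetter_eq h
  refine ⟨a, ha, or_iff_not_imp_left.2 fun hac => ?_⟩
  obtain ⟨h1, m', h2⟩ := of_rem_mul_cliqueProd hc hac (hv ▸ rem_mul_of_self a v)
  exact ⟨hac, h1, m', eq_mul_of_of_rem_eq_some h2⟩

omit [Std.Irrefl I] [Std.Symm I] in
theorem length_mul_cliqueProd (m : TraceMonoid E I) {c : Finset E}
    (hc : (c : Set E).Pairwise I) : length (m * cliqueProd I c) = length m + c.card := by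
  induction c using Finset.induction_on with
  | empty => simp [cliqueProd_empty]
  | insert b c hb ih =>
    rw [cliqueProd_insert hb hc, ← mul_assoc, length_mul_of, ih (hc.mono (by simp)),
      Finset.card_insert_of_notMem hb, add_assoc]

omit [LinearOrder E] [Std.Irrefl I] [Std.Symm I] in
theorem eq_one_of_length_eq_zero {m : TraceMonoid E I} (h : length m = 0) : m = 1 := by
  by_contra hm
  obtain ⟨v, a, rfl⟩ := exists_eq_mul_of hm
  simp at h

theorem koszulLeft_homotopy_add {m : TraceMonoid E I} {c : Finset E}
    (hc : (c : Set E).Pairwise I) (h : m * cliqueProd I c ≠ 1) (x : N) :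
    koszulLeft (koszulHomotopy (Ind.single m c x)) + koszulHomotopy (koszulLeft (Ind.single m c x))
      = Ind.single m c x := by
  obtain ⟨a, ha, hac | ⟨hac, hI, m, rfl⟩⟩ := exists_lastLetter_mul_cliqueProd_eq hc h
  · rw [koszulHomotopy_single_of_mem ha hac, map_zero, zero_add, koszulLeft_single, map_sum]
    have hlast : ∀ b ∈ c,
        lastLetter (m * of E I b * cliqueProd I (c.erase b)) = some a := fun b hb => by
      rw [mul_assoc, of_mul_cliqueProd_erase hb hc, ha]
    rw [Finset.sum_eq_single_of_mem a hac fun b hb hba => by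
      rw [map_zsmul, koszulHomotopy_single_of_mem (hlast b hb)
        (Finset.mem_erase.2 ⟨hba.symm, hac⟩), smul_zero]]
    rw [map_zsmul, koszulHomotopy_single_of_notMem (hlast a hac) (Finset.notMem_erase a c),
      Finset.insert_erase hac, smul_smul, koszulSign_mul_self, one_smul]
  · rw [koszulHomotopy_single_of_notMem ha hac, map_zsmul, koszulLeft_single, koszulLeft_single,
      Finset.sum_insert hac, Finset.erase_insert hac, smul_add, smul_smul, koszulSign_mul_self,
      one_smul, add_assoc, map_sum, Finset.smul_sum, ← Finset.sum_add_distrib]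
    refine add_eq_left.2 (Finset.sum_eq_zero fun b hb => ?_)
    have hab : a ≠ b := fun e => hac (e ▸ hb)
    have hm : m * of E I a * of E I b = m * of E I b * of E I a := by
      rw [mul_assoc, of_mul_of_comm (hI b hb), mul_assoc]
    have hlast :
        lastLetter (m * of E I b * of E I a * cliqueProd I (c.erase b)) = some a := by
      rw [← hm, mul_assoc, of_mul_cliqueProd_erase hb hc, ha]
    have hsign := koszulSign_mul (Finset.mem_insert_self a c) (Finset.mem_insert_of_mem hb) hab
    rw [Finset.erase_insert hac] at hsign
    rw [map_zsmul, hm, koszulHomotopy_single_of_notMem hlast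
        fun h => hac (Finset.mem_of_mem_erase h), smul_smul, smul_smul,
      ← Finset.erase_insert_of_ne hab, hsign, neg_smul, neg_add_cancel]

/-- The index set of the part of weight `< L` of degree `j` of the Koszul complex. -/
def KoszulIndex (I : E → E → Prop) (j L : ℕ) (m : TraceMonoid E I) (c : Finset E) : Prop :=
  ((c : Set E).Pairwise I ∧ c.card = j) ∧ length m + c.card < L

theorem koszulHomotopy_single_mem {j L : ℕ} {m : TraceMonoid E I} {c : Finset E}
    (h : KoszulIndex I j L m c) (x : N) :
    koszulHomotopy (Ind.single m c x) ∈ Ind.supported N (KoszulIndex I (j + 1) L) := by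
  obtain ⟨⟨hc, rfl⟩, hL⟩ := h
  by_cases h : m * cliqueProd I c = 1
  · rw [koszulHomotopy_single_of_eq_one h]
    exact zero_mem _
  obtain ⟨a, ha, hac | ⟨hac, hI, m, rfl⟩⟩ := exists_lastLetter_mul_cliqueProd_eq hc h
  · rw [koszulHomotopy_single_of_mem ha hac]
    exact zero_mem _
  · rw [koszulHomotopy_single_of_notMem ha hac]
    refine zsmul_mem (Ind.single_mem_supported ⟨⟨?_, Finset.card_insert_of_notMem hac⟩, ?_⟩ x) _
    · rw [Finset.coe_insert]
      exact hc.insert_of_symm fun b hb _ => hI b hb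
    · rw [Finset.card_insert_of_notMem hac]
      rw [length_mul_of] at hL
      lia

end Left

variable [Module (MonoidAlgebra R (TraceMonoid E I)) N]

/-- The part of the Koszul differential that lets the letter act on the module. -/
noncomputable def koszulRight (R : Type u) [Ring R]
    [Module (MonoidAlgebra R (TraceMonoid E I)) N] :
    Ind (TraceMonoid E I) (Finset E) N →+ Ind (TraceMonoid E I) (Finset E) N :=
  Ind.lift fun m c => ∑ a ∈ c, koszulSign a c • (Ind.single m (c.erase a)).comp
    (DistribSMul.toAddMonoidHom N (MonoidAlgebra.single (of E I a) (1 : R)))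

theorem koszulRight_single (m : TraceMonoid E I) (c : Finset E) (x : N) :
    koszulRight R (Ind.single m c x) =
      ∑ a ∈ c, koszulSign a c •
        Ind.single m (c.erase a) (MonoidAlgebra.single (of E I a) (1 : R) • x) := by
  simp [koszulRight]

variable [Module R N] (hN : ∀ (r : R) (x : N),
  r • x = MonoidAlgebra.single (1 : TraceMonoid E I) r • x)

omit [LinearOrder E] in
include hN in
theorem letter_smul_comm (a : E) (r : R) (x : N) :
    MonoidAlgebra.single (of E I a) (1 : R) • r • x =
      r • MonoidAlgebra.single (of E I a) (1 : R) • x := by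
  simp only [hN, smul_smul, MonoidAlgebra.single_mul_single, one_mul, mul_one]

/-- The Koszul differential. -/
noncomputable def koszulD : Ind (TraceMonoid E I) (Finset E) N
    →ₗ[MonoidAlgebra R (TraceMonoid E I)] Ind (TraceMonoid E I) (Finset E) N :=
  Ind.toLinearMap (koszulLeft - koszulRight R) fun m r m' c x => by
    simp only [AddMonoidHom.sub_apply, koszulLeft_single, koszulRight_single, smul_sub,
      Finset.smul_sum, letter_smul_comm hN, smul_comm (MonoidAlgebra.single m r),
      Ind.single_smul_single, mul_assoc]

theorem koszulD_apply (y : Ind (TraceMonoid E I) (Finset E) N) :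
    koszulD hN y = koszulLeft y - koszulRight R y := rfl

theorem koszulD_single (m : TraceMonoid E I) (c : Finset E) (x : N) :
    koszulD hN (Ind.single m c x) = ∑ a ∈ c, koszulSign a c •
      (Ind.single (m * of E I a) (c.erase a) x -
        Ind.single m (c.erase a) (MonoidAlgebra.single (of E I a) (1 : R) • x)) := by
  simp only [koszulD_apply, koszulLeft_single, koszulRight_single, smul_sub,
    Finset.sum_sub_distrib]

/-- The augmentation of the Koszul complex. -/
noncomputable def koszulAug : Ind (TraceMonoid E I) (Finset E) N
    →ₗ[MonoidAlgebra R (TraceMonoid E I)] N :=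
  Ind.toLinearMap (Ind.lift fun m c =>
      if c = ∅ then DistribSMul.toAddMonoidHom N (MonoidAlgebra.single m (1 : R)) else 0)
    fun m r m' c x => by
      by_cases hc : c = ∅
      · simp [hc, hN, smul_smul, MonoidAlgebra.single_mul_single]
      · simp [hc]

theorem koszulAug_single (m : TraceMonoid E I) (c : Finset E) (x : N) :
    koszulAug hN (Ind.single m c x) = if c = ∅ then MonoidAlgebra.single m (1 : R) • x else 0 := by
  change Ind.lift (fun (m : TraceMonoid E I) (c : Finset E) => if c = ∅ then
    DistribSMul.toAddMonoidHom N (MonoidAlgebra.single m (1 : R)) else 0) _ = _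
  rw [Ind.lift_single]
  split_ifs <;> rfl

theorem koszulAug_single_empty (m : TraceMonoid E I) (x : N) :
    koszulAug hN (Ind.single m ∅ x) = MonoidAlgebra.single m (1 : R) • x := by
  rw [koszulAug_single, if_pos rfl]

theorem koszulAug_single_of_ne (m : TraceMonoid E I) {c : Finset E} (hc : c ≠ ∅) (x : N) :
    koszulAug hN (Ind.single m c x) = 0 := by
  rw [koszulAug_single, if_neg hc]

theorem koszulAug_koszulD (y : Ind (TraceMonoid E I) (Finset E) N) :
    koszulAug hN (koszulD hN y) = 0 := by
  induction y using Ind.induction with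
  | zero => simp
  | add a b ha hb => rw [map_add, map_add, ha, hb, add_zero]
  | single m c x =>
    rw [koszulD_single, map_sum]
    refine Finset.sum_eq_zero fun a _ => ?_
    rw [map_zsmul, map_sub]
    by_cases hc : c.erase a = ∅
    · rw [hc, koszulAug_single_empty, koszulAug_single_empty, smul_smul,
        MonoidAlgebra.single_mul_single, one_mul, sub_self, smul_zero]
    · rw [koszulAug_single_of_ne hN _ hc, koszulAug_single_of_ne hN _ hc, sub_self, smul_zero]

theorem koszulD_koszulD_single {m : TraceMonoid E I} {c : Finset E} (hc : (c : Set E).Pairwise I)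
    (x : N) : koszulD hN (koszulD hN (Ind.single m c x)) = 0 := by
  rw [koszulD_single, map_sum]
  simp only [map_zsmul, map_sub, koszulD_single, ← Finset.sum_sub_distrib, ← smul_sub]
  refine sum_koszulSign_eq_zero c _ fun a ha b hb hab => ?_
  have h := of_mul_of_comm (hc ha hb hab)
  rw [mul_assoc m, h, ← mul_assoc m, Finset.erase_right_comm, smul_smul, smul_smul,
    MonoidAlgebra.single_mul_single, MonoidAlgebra.single_mul_single, h]
  abel

end Koszul

end TraceMonoid

namespace TraceMonoid

section KoszulExact

variable {E : Type u} {I : E → E → Prop} [LinearOrder E] {R : Type u} [Ring R] {N : Type u}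
  [AddCommGroup N] [Module (MonoidAlgebra R (TraceMonoid E I)) N]

theorem koszulRight_single_mem {j L : ℕ} {m : TraceMonoid E I} {c : Finset E}
    (h : KoszulIndex I (j + 1) (L + 1) m c) (x : N) :
    koszulRight R (Ind.single m c x) ∈ Ind.supported N (KoszulIndex I j L) := by
  obtain ⟨⟨hc, hj⟩, hL⟩ := h
  rw [koszulRight_single]
  refine sum_mem fun a ha => zsmul_mem (Ind.single_mem_supported ⟨⟨hc.mono (by simp), ?_⟩, ?_⟩ _) _
  · rw [Finset.card_erase_of_mem ha, hj, Nat.add_sub_cancel]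
  · have := Finset.card_erase_add_one ha
    lia

theorem koszulHomotopy_koszulRight_single_mem [Std.Irrefl I] [Std.Symm I] {j L : ℕ}
    {m : TraceMonoid E I} {c : Finset E} (h : KoszulIndex I j (L + 1) m c) (x : N) :
    koszulHomotopy (koszulRight R (Ind.single m c x)) ∈ Ind.supported N (KoszulIndex I j L) := by
  cases j with
  | zero =>
    rw [koszulRight_single, Finset.card_eq_zero.1 h.1.2, Finset.sum_empty, map_zero]
    exact zero_mem _
  | succ j =>
    exact Ind.map_mem_of_supported _ _ (fun _ _ h => koszulHomotopy_single_mem h)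
      (koszulRight_single_mem h x)

variable [Module R N] (hN : ∀ (r : R) (x : N),
  r • x = MonoidAlgebra.single (1 : TraceMonoid E I) r • x)

theorem eq_zero_of_koszulAug_eq_zero {j : ℕ} {y : Ind (TraceMonoid E I) (Finset E) N}
    (hy : y ∈ Ind.supported N (KoszulIndex I j 1)) (h : koszulAug hN y = 0) : y = 0 := by
  have := Ind.map_eq_zero_of_supported (AddMonoidHom.id _ -
    (Ind.single 1 ∅).comp (koszulAug hN).toAddMonoidHom) (fun m c hmc x => ?_) hy
  · simpa [h] using this
  · have hc : c = ∅ := Finset.card_eq_zero.1 (by have := hmc.2; lia)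
    have hm : m = 1 := eq_one_of_length_eq_zero (by have := hmc.2; lia)
    simp [hc, hm, koszulAug_single_empty, ← MonoidAlgebra.one_def]

variable [Std.Irrefl I] [Std.Symm I]

theorem exists_koszulD_eq_of_lt {j : ℕ} (L : ℕ) : ∀ y : Ind (TraceMonoid E I) (Finset E) N,
    y ∈ Ind.supported N (KoszulIndex I j (L + 1)) → koszulD hN y = 0 → koszulAug hN y = 0 →
    ∃ z ∈ Ind.supported N fun (_ : TraceMonoid E I) (c : Finset E) =>
      (c : Set E).Pairwise I ∧ c.card = j + 1, koszulD hN z = y := by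
  induction L with
  | zero =>
    intro y hy _ h
    exact ⟨0, zero_mem _, by rw [map_zero, eq_zero_of_koszulAug_eq_zero hN hy h]⟩
  | succ L ih =>
    intro y hy hd hε
    have hz := Ind.map_mem_of_supported koszulHomotopy _
      (fun _ _ h => koszulHomotopy_single_mem h) hy
    have hmem : y - koszulD hN (koszulHomotopy y) ∈ Ind.supported N (KoszulIndex I j (L + 1)) := by
      have h1 : y - koszulLeft (koszulHomotopy y) - koszulHomotopy (koszulLeft y) ∈
          Ind.supported N (KoszulIndex I j (L + 1)) := by
        refine Ind.map_mem_of_supported (AddMonoidHom.id _ - koszulLeft.comp koszulHomotopy -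
          koszulHomotopy.comp koszulLeft) _ (fun m c hmc x => ?_) hy
        by_cases h : m * cliqueProd I c = 1
        · have hl := length_mul_cliqueProd m hmc.1.1
          rw [h, length_one] at hl
          have hc : c = ∅ := Finset.card_eq_zero.1 (by lia)
          refine (congrArg (· ∈ _) ?_).mpr (Ind.single_mem_supported
            (P := KoszulIndex I j (L + 1)) (m := m) (j := c) ⟨hmc.1, by lia⟩ x)
          have hx : koszulLeft (Ind.single m c x) = 0 := by
            rw [koszulLeft_single, hc, Finset.sum_empty]
          simp [koszulHomotopy_single_of_eq_one h, hx]
        · refine (congrArg (· ∈ _) ?_).mpr (zero_mem _)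
          simp only [AddMonoidHom.sub_apply, AddMonoidHom.comp_apply, AddMonoidHom.id_apply]
          rw [sub_sub, koszulLeft_homotopy_add hmc.1.1 h, sub_self]
      have h2 := Ind.map_mem_of_supported (koszulHomotopy.comp (koszulRight R)) _
        (fun _ _ h => koszulHomotopy_koszulRight_single_mem h) hy
      have h3 := Ind.map_mem_of_supported (koszulRight R) _
        (fun _ _ h => koszulRight_single_mem h) hz
      have hLR : koszulLeft y = koszulRight R y := sub_eq_zero.1 hd
      rw [hLR] at h1
      refine (congrArg (· ∈ _) ?_).mpr (add_mem (add_mem h1 h2) h3)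
      rw [koszulD_apply, AddMonoidHom.comp_apply]
      abel
    have hdd : koszulD hN (koszulD hN (koszulHomotopy y)) = 0 :=
      Ind.map_eq_zero_of_supported ((koszulD hN).toAddMonoidHom.comp
        (koszulD hN).toAddMonoidHom) (fun m c h x => koszulD_koszulD_single hN h.1.1 x) hz
    obtain ⟨z, hz', hzy⟩ := ih _ hmem (by rw [map_sub, hd, hdd, sub_zero])
      (by rw [map_sub, hε, koszulAug_koszulD, sub_zero])
    exact ⟨z + koszulHomotopy y, add_mem hz' (Ind.supported_mono (fun _ _ h => h.1) hz),
      by rw [map_add, hzy, sub_add_cancel]⟩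

/-- The term of degree `j` of the Koszul complex. -/
noncomputable def koszulTerm (E : Type u) (I : E → E → Prop) (R N : Type u) [Ring R]
    [AddCommGroup N] [Module R N] (j : ℕ) :
    Submodule (MonoidAlgebra R (TraceMonoid E I)) (Ind (TraceMonoid E I) (Finset E) N) :=
  Ind.supportedSubmodule R (TraceMonoid E I) N fun c : Finset E =>
    (c : Set E).Pairwise I ∧ c.card = j

omit [LinearOrder E] [Module (MonoidAlgebra R (TraceMonoid E I)) N] [Std.Irrefl I]
  [Std.Symm I] in
theorem single_mem_koszulTerm {j : ℕ} {c : Finset E} (hc : (c : Set E).Pairwise I)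
    (hj : c.card = j) (m : TraceMonoid E I) (x : N) :
    Ind.single m c x ∈ koszulTerm E I R N j :=
  Ind.single_mem_supported (P := fun _ (b : Finset E) => (b : Set E).Pairwise I ∧ b.card = j)
    ⟨hc, hj⟩ x

/-- The cycles of degree `j` of the augmented Koszul complex. -/
noncomputable def koszulCycles (j : ℕ) :
    Submodule (MonoidAlgebra R (TraceMonoid E I)) (Ind (TraceMonoid E I) (Finset E) N) :=
  koszulTerm E I R N j ⊓ (LinearMap.ker (koszulD hN) ⊓ LinearMap.ker (koszulAug hN))

theorem exists_koszulD_eq {j : ℕ} {y : Ind (TraceMonoid E I) (Finset E) N}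
    (hy : y ∈ koszulCycles hN j) : ∃ z ∈ koszulTerm E I R N (j + 1), koszulD hN z = y := by
  obtain ⟨hy, hd, hε⟩ := hy
  obtain ⟨L, hL⟩ := Ind.exists_mem_supported_lt (fun m c => length m + c.card) hy
  exact exists_koszulD_eq_of_lt hN L y
    (Ind.supported_mono (fun _ _ h => ⟨h.1, h.2.trans L.lt_succ_self⟩) hL) hd hε

omit [Std.Irrefl I] [Std.Symm I] in
theorem koszulD_mem_koszulCycles {j : ℕ} {y : Ind (TraceMonoid E I) (Finset E) N}
    (hy : y ∈ koszulTerm E I R N (j + 1)) : koszulD hN y ∈ koszulCycles hN j := by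
  refine ⟨Ind.map_mem_of_supported (koszulD hN).toAddMonoidHom
    (koszulTerm E I R N j).toAddSubgroup (fun m c h x => ?_) hy,
    Ind.map_eq_zero_of_supported ((koszulD hN).toAddMonoidHom.comp (koszulD hN).toAddMonoidHom)
      (fun m c h x => koszulD_koszulD_single hN h.1 x) hy, koszulAug_koszulD hN y⟩
  change koszulD hN _ ∈ koszulTerm E I R N j
  rw [koszulD_single]
  refine sum_mem fun a ha => zsmul_mem ?_ _
  have hc : ((c.erase a : Finset E) : Set E).Pairwise I := h.1.mono (by simp)
  have hj : (c.erase a).card = j := by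
    rw [Finset.card_erase_of_mem ha, h.2, Nat.add_sub_cancel]
  exact sub_mem (single_mem_koszulTerm hc hj _ _) (single_mem_koszulTerm hc hj _ _)

omit [Std.Irrefl I] [Std.Symm I] in
theorem koszulAug_eq_zero {j : ℕ} {y : Ind (TraceMonoid E I) (Finset E) N}
    (hy : y ∈ koszulTerm E I R N (j + 1)) : koszulAug hN y = 0 :=
  Ind.map_eq_zero_of_supported (koszulAug hN).toAddMonoidHom (fun m c h x =>
    koszulAug_single_of_ne hN m (Finset.card_ne_zero.1 (by rw [h.2]; lia)).ne_empty x) hy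

omit [Std.Irrefl I] [Std.Symm I] in
theorem koszulD_eq_zero {y : Ind (TraceMonoid E I) (Finset E) N}
    (hy : y ∈ koszulTerm E I R N 0) : koszulD hN y = 0 :=
  Ind.map_eq_zero_of_supported (koszulD hN).toAddMonoidHom (fun m c h x => by
    change koszulD hN _ = 0
    rw [koszulD_single, Finset.card_eq_zero.1 h.2, Finset.sum_empty]) hy

omit [LinearOrder E] [Module (MonoidAlgebra R (TraceMonoid E I)) N] [Std.Irrefl I]
  [Std.Symm I] in
theorem pdLT_koszulTerm {n : ℕ} (h : PdLT R N n) (j : ℕ) :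
    PdLT (MonoidAlgebra R (TraceMonoid E I)) (koszulTerm E I R N j) n :=
  Ind.pdLT_supportedSubmodule _ (PdLT.ind n N h)

theorem pdLT_koszulCycles {n : ℕ} (h : PdLT R N (n + 1)) (i : ℕ) : ∀ j,
    (∀ c : Finset E, (c : Set E).Pairwise I → c.card ≤ j + i) →
    PdLT (MonoidAlgebra R (TraceMonoid E I)) (koszulCycles hN j) (n + i) := by
  induction i with
  | zero =>
    intro j hj
    refine PdLT.mono (pdLT_zero_iff.2 ?_) (Nat.zero_le _)
    have hbot : ∀ z ∈ koszulTerm E I R N (j + 1), z = 0 := fun z hz =>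
      Ind.map_eq_zero_of_supported (AddMonoidHom.id _)
        (fun _ c hc _ => absurd (hj c hc.1) (by rw [hc.2]; lia)) hz
    refine subsingleton_of_forall_eq 0 fun y => Subtype.ext ?_
    obtain ⟨z, hz, hzy⟩ := exists_koszulD_eq hN y.2
    rw [← hzy, hbot z hz, map_zero]
    rfl
  | succ i ih =>
    intro j hj
    let g : koszulTerm E I R N (j + 1) →ₗ[MonoidAlgebra R (TraceMonoid E I)] koszulCycles hN j :=
      (koszulD hN).restrict fun _ => koszulD_mem_koszulCycles hN
    have hg : Function.Surjective g := fun y => by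
      obtain ⟨z, hz, hzy⟩ := exists_koszulD_eq hN y.2
      exact ⟨⟨z, hz⟩, Subtype.ext hzy⟩
    refine PdLT.of_ker hg ((ih (j + 1) fun c hc => (hj c hc).trans (by lia)).of_equiv
      { toFun := fun y => ⟨y.1.1, y.1.2, congrArg Subtype.val y.2, koszulAug_eq_zero hN y.1.2⟩
        invFun := fun y => ⟨⟨y.1, y.2.1⟩, Subtype.ext y.2.2.1⟩
        map_add' := fun _ _ => rfl
        map_smul' := fun _ _ => rfl }) ((pdLT_koszulTerm h _).mono (by lia))

include hN in
theorem pdLT_of_clique_card_le {n k : ℕ} (h : PdLT R N (n + 1))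
    (hk : ∀ c : Finset E, (c : Set E).Pairwise I → c.card ≤ k) :
    PdLT (MonoidAlgebra R (TraceMonoid E I)) N (n + k + 1) := by
  let g : koszulTerm E I R N 0 →ₗ[MonoidAlgebra R (TraceMonoid E I)] N :=
    (koszulAug hN).domRestrict _
  have hg : Function.Surjective g := fun x =>
    ⟨⟨Ind.single 1 ∅ x, single_mem_koszulTerm (by simp) Finset.card_empty 1 x⟩, by
      change koszulAug hN (Ind.single 1 ∅ x) = x
      rw [koszulAug_single_empty, ← MonoidAlgebra.one_def, one_smul]⟩
  refine PdLT.of_ker hg ((pdLT_koszulCycles hN h k 0 fun c hc => (hk c hc).trans (by lia)).of_equiv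
    { toFun := fun y => ⟨y.1.1, y.1.2, koszulD_eq_zero hN y.1.2, y.2⟩
      invFun := fun y => ⟨⟨y.1, y.2.1⟩, y.2.2.2⟩
      map_add' := fun _ _ => rfl
      map_smul' := fun _ _ => rfl }) ((pdLT_koszulTerm h _).mono (by lia))

end KoszulExact

theorem gldLT_monoidAlgebra {E : Type u} {I : E → E → Prop} [Std.Irrefl I] [Std.Symm I]
    {R : Type u} [Ring R] {n k : ℕ} (h : GldLT R (n + 1))
    (hk : ∀ c : Finset E, (c : Set E).Pairwise I → c.card ≤ k) :
    GldLT (MonoidAlgebra R (TraceMonoid E I)) (n + k + 1) := by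
  intro N _ _
  classical
  let : LinearOrder E := linearOrderOfSTO WellOrderingRel
  let : Module R N := Module.compHom N
    (MonoidAlgebra.singleOneRingHom : R →+* MonoidAlgebra R (TraceMonoid E I))
  exact pdLT_of_clique_card_le (fun _ _ => rfl) (h N) hk

end TraceMonoid

theorem ringGlobalDimension_lt_iff (R : Type u) [Ring R] [HasExt.{w} (ModuleCat.{u} R)] (n : ℕ) :
    ringGlobalDimension.{w} R < ((n : ℕ∞) : WithBot ℕ∞) ↔ GldLT R n := by
  constructor
  · intro h N _ _
    refine (hasProjectiveDimensionLT_iff _ _).2 fun i hi Y e => ?_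
    by_contra he
    have hle : ((i : ℕ∞) : WithBot ℕ∞) ≤ ringGlobalDimension.{w} R := by
      rw [ringGlobalDimension, globalDimension]
      exact le_sSup ⟨i, _, _, e, he, rfl⟩
    have : i < n := by exact_mod_cast hle.trans_lt h
    lia
  · intro h
    have key : ∀ (i : ℕ) (X Y : ModuleCat.{u} R) (e : Abelian.Ext X Y i), e ≠ 0 → i < n := by
      intro i X Y e he
      by_contra hi
      have : HasProjectiveDimensionLT X n := h X
      exact he (Abelian.Ext.eq_zero_of_hasProjectiveDimensionLT e n (by lia))
    cases n with
    | zero =>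
      refine (sSup_le (a := ⊥) ?_).trans_lt (WithBot.bot_lt_coe _)
      rintro _ ⟨i, X, Y, e, he, -⟩
      exact absurd (key i X Y e he) (by lia)
    | succ n =>
      refine (sSup_le (a := ((n : ℕ∞) : WithBot ℕ∞)) ?_).trans_lt
        (by exact_mod_cast n.lt_succ_self)
      rintro _ ⟨i, X, Y, e, he, rfl⟩
      exact_mod_cast Nat.le_of_lt_succ (key i X Y e he)

theorem GldLT.mono {R : Type u} [Ring R] {m n : ℕ} (h : GldLT R m) (hmn : m ≤ n) : GldLT R n :=
  fun N _ _ => (h N).mono hmn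

theorem gldLT_zero_iff {R : Type u} [Ring R] : GldLT R 0 ↔ Subsingleton R := by
  refine ⟨fun h => pdLT_zero_iff.1 (h R), fun h N _ _ => pdLT_zero_iff.2 ?_⟩
  exact Module.subsingleton R N

theorem exists_clique_of_le_cliqueNumber {E : Type u} {I : E → E → Prop} {k : ℕ}
    (hk : (k : ℕ∞) ≤ cliqueNumber E I) :
    ∃ f : Fin k → E, Pairwise fun i j => I (f i) (f j) := by
  cases k with
  | zero => exact ⟨Fin.elim0, fun i => i.elim0⟩
  | succ k =>
    have hk' : (k : ℕ∞) < cliqueNumber E I :=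
      lt_of_lt_of_le (by exact_mod_cast k.lt_succ_self) hk
    obtain ⟨⟨s, hs⟩, hks⟩ := lt_iSup_iff.1 hk'
    obtain ⟨t, hts, ht⟩ := Finset.exists_subset_card_eq
      (show k + 1 ≤ s.card by exact_mod_cast hks)
    let e := t.equivFinOfCardEq ht
    exact ⟨fun i => (e.symm i).1, fun i j hij => hs _ (hts (e.symm i).2) _ (hts (e.symm j).2)
      fun h => hij (e.symm.injective (Subtype.ext h))⟩

theorem card_le_of_cliqueNumber_eq {E : Type u} {I : E → E → Prop} {k : ℕ}
    (hk : cliqueNumber E I = k) {c : Finset E} (hc : (c : Set E).Pairwise I) : c.card ≤ k := by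
  have := le_iSup (fun s : {s : Finset E // ∀ a ∈ s, ∀ b ∈ s, a ≠ b → I a b} =>
    (s.1.card : ℕ∞)) ⟨c, fun a ha b hb hab => hc ha hb hab⟩
  exact_mod_cast this.trans_eq hk

/-- For a free partially commutative monoid `M(E,I)` and any ring `R` with `1`, the
global dimension of the monoid ring `R[M(E,I)]` equals `ω(E,I) + gld R`, where
`ω(E,I)` is the clique number of the independence graph. -/
theorem gldim_monoidAlgebra_traceMonoid (E : Type u) (I : E → E → Prop)
    (hirr : ∀ a, ¬ I a a) (hsym : ∀ a b, I a b → I b a)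
    (R : Type u) [Ring R]
    [HasExt.{w} (ModuleCat.{u} R)]
    [HasExt.{w'} (ModuleCat.{u} (MonoidAlgebra R (TraceMonoid E I)))] :
    ringGlobalDimension.{w', u} (MonoidAlgebra R (TraceMonoid E I)) =
      ((cliqueNumber E I : ℕ∞) : WithBot ℕ∞) + ringGlobalDimension.{w, u} R := by
  have : Std.Irrefl I := ⟨hirr⟩
  have : Std.Symm I := ⟨hsym⟩
  have hR := ringGlobalDimension_lt_iff.{w} R
  have hA := ringGlobalDimension_lt_iff.{w'} (MonoidAlgebra R (TraceMonoid E I))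
  have lower : ∀ k n : ℕ, (k : ℕ∞) ≤ cliqueNumber E I →
      GldLT (MonoidAlgebra R (TraceMonoid E I)) (n + k) → GldLT R n := fun k n hk h => by
    obtain ⟨f, hf⟩ := exists_clique_of_le_cliqueNumber hk
    exact TraceMonoid.gldLT_of_clique f hf h
  generalize ringGlobalDimension.{w} R = a at hR ⊢
  generalize ringGlobalDimension.{w'} (MonoidAlgebra R (TraceMonoid E I)) = b at hA ⊢
  by_cases htriv : GldLT R 0
  · have ha : a = ⊥ := WithBot.lt_coe_bot.1 ((hR 0).2 htriv)
    have := gldLT_zero_iff.1 htriv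
    have hb : b = ⊥ := WithBot.lt_coe_bot.1 ((hA 0).2 (gldLT_zero_iff.2
      (Module.subsingleton R _)))
    rw [ha, hb, WithBot.add_bot]
  cases a with
  | bot => exact absurd ((hR 0).1 (WithBot.bot_lt_coe _)) htriv
  | coe a =>
  cases b with
  | bot => exact absurd (lower 0 0 zero_le ((hA 0).1 (WithBot.bot_lt_coe _))) htriv
  | coe b =>
  simp only [WithBot.coe_lt_coe] at hR hA
  rw [← WithBot.coe_add, WithBot.coe_inj]
  have b_eq_top (h : ∀ n, ¬ GldLT (MonoidAlgebra R (TraceMonoid E I)) n) : b = ⊤ := by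
    by_contra hb
    lift b to ℕ using hb
    exact h (b + 1) ((hA _).1 (by exact_mod_cast b.lt_succ_self))
  generalize hω : cliqueNumber E I = ω at lower ⊢
  cases ω with
  | top =>
    rw [top_add, b_eq_top fun n h => htriv (lower n 0 le_top (by rwa [zero_add]))]
  | coe k =>
  cases a with
  | top =>
    rw [add_top, b_eq_top fun n h => ?_]
    exact not_top_lt ((hR n).2 (lower k n le_rfl (h.mono (by lia))))
  | coe a =>
    refine le_antisymm ?_ (not_lt.1 fun h => ?_)
    · have := TraceMonoid.gldLT_monoidAlgebra ((hR (a + 1)).1 (by exact_mod_cast a.lt_succ_self))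
        fun c hc => card_le_of_cliqueNumber_eq hω hc
      rw [add_comm, ← Nat.cast_add]
      exact ENat.lt_natCast_add_one_iff.1 (by exact_mod_cast (hA _).2 this)
    · rw [add_comm, ← Nat.cast_add] at h
      exact lt_irrefl _ ((hR a).2 (lower k a le_rfl ((hA _).1 h)))
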